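/- arXiv:2310.20262 — 10 statements merged into one kernel-verified Lean document; each statement's English description precedes it below -/
import Mathlib

section
/- Let D be a nonempty bounded convex open subset of a finite-dimensional real normed vector space with Hilbert metric d_H, let x₀ ∈ D and l ∈ [0,1). Then the map g : D → D defined by g(x) = x₀ + l·(x − x₀) is contractive with respect to d_H, i.e., d_H(g(x), g(y)) < d_H(x,y) for all distinct x, y ∈ D. -/
/-- `d` is the Hilbert (cross-ratio) metric on the bounded convex open set `D`:
`d x x = 0` on `D`, and for distinct `x y ∈ D` there are boundary points `a b ∈ ∂D`
with `x` between `a` and `y`, `y` between `x` and `b`, and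
`d x y = log ((‖y−a‖ ‖x−b‖)/(‖x−a‖ ‖y−b‖))`. -/
def IsHilbertMetric {V : Type*} [NormedAddCommGroup V] [NormedSpace ℝ V]
    (D : Set V) (d : V → V → ℝ) : Prop :=
  (∀ x ∈ D, d x x = 0) ∧
  ∀ x ∈ D, ∀ y ∈ D, x ≠ y →
    ∃ a ∈ frontier D, ∃ b ∈ frontier D,
      x ∈ segment ℝ a y ∧ y ∈ segment ℝ x b ∧
      d x y = Real.log ((‖y - a‖ * ‖x - b‖) / (‖x - a‖ * ‖y - b‖))

/-- In terms of `v = y - x`, the boundary points are `x - α • v` and `y + β • v` with `α, β > 0`,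
and the Hilbert distance is `log ((1 + α⁻¹) * (1 + β⁻¹))`. -/
lemma IsHilbertMetric.exists_param {V : Type*} [NormedAddCommGroup V] [NormedSpace ℝ V]
    {D : Set V} (hDo : IsOpen D) {d : V → V → ℝ} (hd : IsHilbertMetric D d)
    {x y : V} (hx : x ∈ D) (hy : y ∈ D) (hxy : x ≠ y) :
    ∃ α > 0, ∃ β > 0, x + α • -(y - x) ∈ frontier D ∧ y + β • (y - x) ∈ frontier D ∧
      d x y = Real.log ((1 + α⁻¹) * (1 + β⁻¹)) := by
  obtain ⟨a, ha, b, hb, hxa, hyb, h⟩ := hd.2 x hx y hy hxy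
  have hnot : ∀ z ∈ frontier D, z ∉ D := fun z hz hzD ↦ by
    rw [hDo.frontier_eq] at hz
    exact hz.2 hzD
  have hax : a ≠ x := fun e ↦ hnot a ha (e ▸ hx)
  have hyb' : y ≠ b := fun e ↦ hnot b hb (e ▸ hy)
  obtain ⟨α, hα, rfl⟩ : ∃ α : ℝ, 0 < α ∧ a = x + α • -(y - x) := by
    obtain ⟨r, s, hr, hs, hrs, rfl⟩ := hxa
    have hr0 : r ≠ 0 := by
      rintro rfl
      exact hxy (by simp [show s = 1 by linarith])
    have hs0 : s ≠ 0 := by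
      rintro rfl
      exact hax (by simp [show r = 1 by linarith])
    refine ⟨s / r, by positivity, ?_⟩
    obtain rfl : s = 1 - r := by linarith
    match_scalars <;> field_simp <;> ring
  obtain ⟨β, hβ, rfl⟩ : ∃ β : ℝ, 0 < β ∧ b = y + β • (y - x) := by
    obtain ⟨r, s, hr, hs, hrs, rfl⟩ := hyb
    have hr0 : r ≠ 0 := by
      rintro rfl
      exact hyb' (by simp [show s = 1 by linarith])
    have hs0 : s ≠ 0 := by
      rintro rfl
      exact hxy (by simp [show r = 1 by linarith])
    refine ⟨r / s, by positivity, ?_⟩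
    obtain rfl : s = 1 - r := by linarith
    match_scalars <;> field_simp <;> ring
  refine ⟨α, hα, β, hβ, ha, hb, h.trans (congrArg Real.log ?_)⟩
  have hv : ‖y - x‖ ≠ 0 := norm_ne_zero_iff.2 (sub_ne_zero.2 hxy.symm)
  have hya : ‖y - (x + α • -(y - x))‖ = (1 + α) * ‖y - x‖ := by
    rw [show y - (x + α • -(y - x)) = (1 + α) • (y - x) by module, norm_smul, Real.norm_of_nonneg]
    positivity
  have hxb : ‖x - (y + β • (y - x))‖ = (1 + β) * ‖y - x‖ := by
    rw [show x - (y + β • (y - x)) = -((1 + β) • (y - x)) by module, norm_neg, norm_smul,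
      Real.norm_of_nonneg]
    positivity
  have hxa : ‖x - (x + α • -(y - x))‖ = α * ‖y - x‖ := by
    rw [show x - (x + α • -(y - x)) = α • (y - x) by module, norm_smul,
      Real.norm_of_nonneg hα.le]
  have hyb : ‖y - (y + β • (y - x))‖ = β * ‖y - x‖ := by
    rw [show y - (y + β • (y - x)) = -(β • (y - x)) by module, norm_neg, norm_smul,
      Real.norm_of_nonneg hβ.le]
  rw [hya, hxb, hxa, hyb]
  field_simp
  ring

/-- A homothety with ratio `l < 1` centred in an open convex set maps the closure into the set, so
a ray leaves the set strictly later, relative to scale, after applying the homothety. -/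
lemma Convex.lt_of_homothety_notMem {V : Type*} [NormedAddCommGroup V] [NormedSpace ℝ V]
    {D : Set V} (hDo : IsOpen D) (hDc : Convex ℝ D) {x₀ x v : V} (hx₀ : x₀ ∈ D) (hx : x ∈ D)
    {l t t' : ℝ} (hl : 0 ≤ l) (hl' : l < 1) (ht' : 0 < t')
    (h : x + t • v ∈ closure D) (h' : x₀ + l • (x - x₀) + t' • (l • v) ∉ D) : t < t' := by
  by_contra! hle
  have ht : 0 < t := ht'.trans_le hle
  have hmem : ∀ z ∈ closure D, x₀ + l • (z - x₀) ∈ D := fun z hz ↦ by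
    have := hDc.combo_interior_closure_mem_interior (hDo.interior_eq.symm ▸ hx₀) hz
      (sub_pos.2 hl') hl (sub_add_cancel 1 l)
    rw [hDo.interior_eq] at this
    convert this using 1
    module
  refine h' ?_
  convert hDc (hmem x (subset_closure hx)) (hmem _ h) (sub_nonneg.2 ((div_le_one ht).2 hle))
    (by positivity) (sub_add_cancel 1 (t' / t)) using 1
  match_scalars <;> field_simp <;> ring

theorem hilbert_metric_homothety_contractive
    {V : Type*} [NormedAddCommGroup V] [NormedSpace ℝ V] [FiniteDimensional ℝ V]
    (D : Set V) (hDo : IsOpen D) (hDc : Convex ℝ D) (hDb : Bornology.IsBounded D)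
    (hDn : D.Nonempty)
    (dH : V → V → ℝ) (hdH : IsHilbertMetric D dH)
    (x₀ : V) (hx₀ : x₀ ∈ D) (l : ℝ) (hl : l ∈ Set.Ico (0 : ℝ) 1) :
    ∀ x ∈ D, ∀ y ∈ D, x ≠ y →
      dH (x₀ + l • (x - x₀)) (x₀ + l • (y - x₀)) < dH x y := by
  intro x hx y hy hxy
  obtain ⟨α, hα, β, hβ, ha, hb, h⟩ := hdH.exists_param hDo hx hy hxy
  have hD : ∀ z ∈ D, x₀ + l • (z - x₀) ∈ D := fun z hz ↦
    hDc.add_smul_sub_mem hx₀ hz ⟨hl.1, hl.2.le⟩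
  rw [h]
  rcases hl.1.eq_or_lt with rfl | hl0
  · have : 1 < (1 + α⁻¹) * (1 + β⁻¹) :=
      one_lt_mul_of_lt_of_le (lt_add_of_pos_right 1 (inv_pos.2 hα))
        (le_add_of_nonneg_right (inv_pos.2 hβ).le)
    simpa [hdH.1 x₀ hx₀] using Real.log_pos this
  · have hg : x₀ + l • (x - x₀) ≠ x₀ + l • (y - x₀) := by
      simpa [hl0.ne'] using hxy
    obtain ⟨α', hα', β', hβ', ha', hb', h'⟩ := hdH.exists_param hDo (hD x hx) (hD y hy) hg
    have hgv : x₀ + l • (y - x₀) - (x₀ + l • (x - x₀)) = l • (y - x) := by module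
    rw [hgv] at hb'
    rw [hgv, ← smul_neg] at ha'
    rw [hDo.frontier_eq] at ha hb ha' hb'
    have hαα' := Convex.lt_of_homothety_notMem hDo hDc hx₀ hx hl.1 hl.2 hα' ha.1 ha'.2
    have hββ' := Convex.lt_of_homothety_notMem hDo hDc hx₀ hy hl.1 hl.2 hβ' hb.1 hb'.2
    rw [h']
    gcongr
end

section
/- Let D be a nonempty bounded convex open subset of a finite-dimensional real normed vector space with Hilbert metric d_H. If {x_n} is a sequence in D converging in norm to a boundary point ξ ∈ ∂D = closure(D) \ D, then for every w ∈ D one has d_H(x_n, w) → ∞ as n → ∞. -/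
/-- In a convex set containing the ball of radius `r` around `w`, a point that divides the segment
from a closure point `a` to `w` in the ratio `q : 1 - q` is at distance at least `q * r` from every
point outside the set. -/
theorem Convex.mul_le_norm_sub_of_notMem {V : Type*} [NormedAddCommGroup V] [NormedSpace ℝ V]
    {D : Set V} (hDc : Convex ℝ D) {w a ξ : V} {r p q : ℝ} (hr : Metric.ball w r ⊆ D)
    (ha : a ∈ closure D) (hξ : ξ ∉ D) (hp : 0 ≤ p) (hq : 0 < q) (hpq : p + q = 1) :
    q * r ≤ ‖p • a + q • w - ξ‖ := by
  by_contra! hlt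
  have hball : w + q⁻¹ • (ξ - (p • a + q • w)) ∈ Metric.ball w r := by
    rw [Metric.mem_ball, dist_eq_norm, add_sub_cancel_left, norm_smul, norm_sub_rev,
      Real.norm_of_nonneg (inv_nonneg.2 hq.le), inv_mul_lt_iff₀ hq]
    exact hlt
  have hint := interior_maximal hr Metric.isOpen_ball hball
  have hmem := interior_subset (hDc.combo_closure_interior_mem_interior ha hint hp hq hpq)
  rw [smul_add, smul_inv_smul₀ hq.ne', ← add_assoc, add_sub_cancel] at hmem
  exact hξ hmem

/-- The Hilbert distance from `x` to the centre `w` of a ball in `D` is bounded below in terms of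
the distance from `x` to any point outside `D`. -/
theorem IsHilbertMetric.log_div_le {V : Type*} [NormedAddCommGroup V] [NormedSpace ℝ V]
    {D : Set V} (hDo : IsOpen D) (hDc : Convex ℝ D) {d : V → V → ℝ} (hd : IsHilbertMetric D d)
    {x w ξ : V} {r : ℝ} (hx : x ∈ D) (hxw : x ≠ w) (hξ : ξ ∉ D) (hr₀ : 0 < r)
    (hr : Metric.ball w r ⊆ D) : Real.log (r / ‖x - ξ‖) ≤ d x w := by
  have hw : w ∈ D := hr (Metric.mem_ball_self hr₀)
  obtain ⟨a, ha, b, hb, ⟨p, q, hp, hq, hpq, hxa⟩, hwb, hdist⟩ := hd.2 x hx w hw hxw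
  have hfr : ∀ {z y : V}, z ∈ frontier D → y ∈ D → 0 < ‖y - z‖ := by
    intro z y hz hy
    refine norm_pos_iff.2 (sub_ne_zero.2 ?_)
    rintro rfl
    exact (hDo.frontier_eq ▸ hz).2 hy
  have hxξ : 0 < ‖x - ξ‖ := norm_pos_iff.2 (sub_ne_zero.2 fun h => hξ (h ▸ hx))
  have hnorm : ‖x - a‖ = q * ‖w - a‖ := by
    have : x - a = q • (w - a) := by
      rw [← hxa, eq_sub_of_add_eq hpq]
      module
    rw [this, norm_smul, Real.norm_of_nonneg hq]
  have hxa₀ := hfr ha hx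
  have hwa₀ := hfr ha hw
  have hwb₀ := hfr hb hw
  have hq₀ : 0 < q := hq.lt_of_ne' fun h => by simp [hnorm, h] at hxa₀
  have hqr : q * r ≤ ‖x - ξ‖ :=
    hxa ▸ hDc.mul_le_norm_sub_of_notMem hr (frontier_subset_closure ha) hξ hp hq₀ hpq
  have hxb : ‖w - b‖ ≤ ‖x - b‖ := by
    have := dist_add_dist_of_mem_segment hwb
    rw [dist_eq_norm, dist_eq_norm, dist_eq_norm] at this
    linarith [norm_nonneg (x - w)]
  rw [hdist]
  refine Real.log_le_log (by positivity) ?_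
  rw [div_le_div_iff₀ hxξ (by positivity), hnorm]
  calc r * (q * ‖w - a‖ * ‖w - b‖) = ‖w - a‖ * ‖w - b‖ * (q * r) := by ring
    _ ≤ ‖w - a‖ * ‖x - b‖ * ‖x - ξ‖ := by gcongr

theorem hilbert_metric_tendsto_atTop_of_tendsto_boundary
    {V : Type*} [NormedAddCommGroup V] [NormedSpace ℝ V] [FiniteDimensional ℝ V]
    (D : Set V) (hDo : IsOpen D) (hDc : Convex ℝ D) (hDb : Bornology.IsBounded D)
    (hDn : D.Nonempty)
    (dH : V → V → ℝ) (hdH : IsHilbertMetric D dH) :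
    ∀ (xn : ℕ → V), (∀ n, xn n ∈ D) → ∀ ξ ∈ closure D \ D,
      Filter.Tendsto xn Filter.atTop (nhds ξ) →
      ∀ w ∈ D, Filter.Tendsto (fun n => dH (xn n) w) Filter.atTop Filter.atTop := by
  intro xn hxn ξ hξ hlim w hw
  obtain ⟨r, hr₀, hr⟩ := Metric.isOpen_iff.1 hDo w hw
  have hne : ∀ᶠ n in Filter.atTop, xn n ≠ w :=
    hlim.eventually_ne fun h => hξ.2 (h ▸ hw)
  have hpos : ∀ n, 0 < ‖xn n - ξ‖ := fun n =>
    norm_pos_iff.2 (sub_ne_zero.2 fun h => hξ.2 (h ▸ hxn n))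
  have hzero : Filter.Tendsto (fun n => ‖xn n - ξ‖) Filter.atTop (nhdsWithin 0 (Set.Ioi 0)) :=
    tendsto_nhdsWithin_iff.2
      ⟨tendsto_iff_norm_sub_tendsto_zero.1 hlim, Filter.Eventually.of_forall hpos⟩
  have hdiv : Filter.Tendsto (fun n => r / ‖xn n - ξ‖) Filter.atTop Filter.atTop := by
    simpa only [div_eq_mul_inv, Pi.inv_apply] using
      hzero.inv_tendsto_nhdsGT_zero.const_mul_atTop hr₀
  refine Filter.tendsto_atTop_mono' _ ?_ (Real.tendsto_log_atTop.comp hdiv)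
  filter_upwards [hne] with n hn
  exact hdH.log_div_le hDo hDc (hxn n) hn hξ.2 hr₀ hr
end

section
/- Let D be a nonempty bounded convex open subset of a finite-dimensional real normed vector space with Hilbert metric d_H. Then the metric space (D, d_H) is proper: every closed and bounded subset of (D, d_H) is compact; equivalently, every closed ball of (D, d_H) is compact. -/
/-- The gauge of `D` recentred at `x`. -/
noncomputable def gaugeAt {V : Type*} [NormedAddCommGroup V] [NormedSpace ℝ V]
    (D : Set V) (x v : V) : ℝ :=
  gauge ((x + ·) ⁻¹' D) v

theorem preimage_add_left_mem_nhds_zero {V : Type*} [NormedAddCommGroup V] {D : Set V} {x : V}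
    (hDo : IsOpen D) (hx : x ∈ D) :
    (x + ·) ⁻¹' D ∈ nhds (0 : V) :=
  (hDo.preimage (continuous_const_add x)).mem_nhds (by simpa using hx)

section GaugeAt

variable {V : Type*} [NormedAddCommGroup V] [NormedSpace ℝ V] {D : Set V} {x : V}

theorem continuous_gaugeAt (hDo : IsOpen D) (hDc : Convex ℝ D) (hx : x ∈ D) :
    Continuous (gaugeAt D x) :=
  continuous_gauge (hDc.translate_preimage_right x) (preimage_add_left_mem_nhds_zero hDo hx)

theorem gaugeAt_nonneg (v : V) : 0 ≤ gaugeAt D x v := gauge_nonneg v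

theorem gaugeAt_smul {c : ℝ} (hc : 0 ≤ c) (v : V) : gaugeAt D x (c • v) = c * gaugeAt D x v :=
  gauge_smul_of_nonneg hc v

theorem gaugeAt_sub_lt_one_iff (hDo : IsOpen D) (hDc : Convex ℝ D) (hx : x ∈ D) {y : V} :
    gaugeAt D x (y - x) < 1 ↔ y ∈ D := by
  rw [gaugeAt, gauge_lt_one_iff_mem_interior (hDc.translate_preimage_right x)
    (preimage_add_left_mem_nhds_zero hDo hx),
    (hDo.preimage (continuous_const_add x)).interior_eq]
  simp

theorem gaugeAt_sub_eq_one (hDo : IsOpen D) (hDc : Convex ℝ D) (hx : x ∈ D) {b : V}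
    (hb : b ∈ frontier D) : gaugeAt D x (b - x) = 1 := by
  rw [gaugeAt, gauge_eq_one_iff_mem_frontier (hDc.translate_preimage_right x)
    (preimage_add_left_mem_nhds_zero hDo hx)]
  have h := (Homeomorph.addLeft x).preimage_frontier D
  rw [Homeomorph.coe_addLeft] at h
  rw [← h]
  simpa using hb

theorem norm_div_norm_eq_inv_one_sub_gaugeAt (hDo : IsOpen D) (hDc : Convex ℝ D) (hx : x ∈ D)
    {y b : V} (hxy : x ≠ y) (hb : b ∈ frontier D) (hyb : y ∈ segment ℝ x b) :
    ‖x - b‖ / ‖y - b‖ = (1 - gaugeAt D x (y - x))⁻¹ := by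
  obtain ⟨u, t, hu, ht, hut, rfl⟩ := hyb
  obtain rfl : u = 1 - t := by linarith
  have hxb : x ≠ b := by
    rintro rfl
    exact hxy (by module)
  have hg : gaugeAt D x ((1 - t) • x + t • b - x) = t := by
    rw [show (1 - t) • x + t • b - x = t • (b - x) by module, gaugeAt_smul ht,
      gaugeAt_sub_eq_one hDo hDc hx hb, mul_one]
  have hn : ‖x - b‖ ≠ 0 := norm_ne_zero_iff.2 (sub_ne_zero.2 hxb)
  rw [hg, show (1 - t) • x + t • b - b = (1 - t) • (x - b) by module, norm_smul,
    Real.norm_of_nonneg hu, div_mul_cancel_right₀ hn]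

theorem norm_div_norm_eq_one_add_gaugeAt (hDo : IsOpen D) (hDc : Convex ℝ D) (hx : x ∈ D)
    {y a : V} (hxy : x ≠ y) (ha : a ∈ frontier D) (hxa : x ∈ segment ℝ a y) :
    ‖y - a‖ / ‖x - a‖ = 1 + gaugeAt D x (x - y) := by
  obtain ⟨u, s, hu, hs, hus, h⟩ := hxa
  obtain rfl : u = 1 - s := by linarith
  have hs0 : s ≠ 0 := by
    rintro rfl
    obtain rfl : a = x := by simpa using h
    rw [hDo.frontier_eq] at ha
    exact ha.2 hx
  have hya : y - a ≠ 0 := by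
    intro h0
    obtain rfl : y = a := sub_eq_zero.1 h0
    exact hxy (by rw [← h]; module)
  have hsub : s • (x - y) = (1 - s) • (a - x) := by
    rw [← h]
    module
  have hg : s * gaugeAt D x (x - y) = 1 - s := by
    rw [← gaugeAt_smul hs, hsub, gaugeAt_smul hu, gaugeAt_sub_eq_one hDo hDc hx ha, mul_one]
  have hxa : x - a = s • (y - a) := by
    rw [← h]
    module
  have hn : ‖y - a‖ ≠ 0 := norm_ne_zero_iff.2 hya
  rw [hxa, norm_smul, Real.norm_of_nonneg hs, div_mul_cancel_right₀ hn]
  field_simp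
  linarith

end GaugeAt

theorem IsHilbertMetric.eq_log_gaugeAt
    {V : Type*} [NormedAddCommGroup V] [NormedSpace ℝ V] {D : Set V} {d : V → V → ℝ}
    (hd : IsHilbertMetric D d) (hDo : IsOpen D) (hDc : Convex ℝ D) {x y : V}
    (hx : x ∈ D) (hy : y ∈ D) :
    d x y = Real.log ((1 + gaugeAt D x (x - y)) / (1 - gaugeAt D x (y - x))) := by
  rcases eq_or_ne x y with rfl | hxy
  · simp [hd.1 x hx, gaugeAt]
  · obtain ⟨a, ha, b, hb, hxa, hyb, h⟩ := hd.2 x hx y hy hxy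
    rw [h, mul_div_mul_comm, norm_div_norm_eq_one_add_gaugeAt hDo hDc hx hxy ha hxa,
      norm_div_norm_eq_inv_one_sub_gaugeAt hDo hDc hx hxy hb hyb, div_eq_mul_inv]

theorem IsHilbertMetric.closedBall_eq
    {V : Type*} [NormedAddCommGroup V] [NormedSpace ℝ V] {D : Set V} {d : V → V → ℝ}
    (hd : IsHilbertMetric D d) (hDo : IsOpen D) (hDc : Convex ℝ D) {x : V} (hx : x ∈ D) (r : ℝ) :
    {y ∈ D | d x y ≤ r} =
      {y | 1 + gaugeAt D x (x - y) ≤ Real.exp r * (1 - gaugeAt D x (y - x))} := by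
  have key {y : V} (hy : y ∈ D) : d x y ≤ r ↔
      1 + gaugeAt D x (x - y) ≤ Real.exp r * (1 - gaugeAt D x (y - x)) := by
    have hnum : 0 < 1 + gaugeAt D x (x - y) := by
      linarith [gaugeAt_nonneg (D := D) (x := x) (x - y)]
    have hden : 0 < 1 - gaugeAt D x (y - x) :=
      sub_pos.2 ((gaugeAt_sub_lt_one_iff hDo hDc hx).2 hy)
    rw [hd.eq_log_gaugeAt hDo hDc hx hy, Real.log_le_iff_le_exp (div_pos hnum hden),
      div_le_iff₀ hden]
  ext y
  refine ⟨fun h ↦ (key h.1).1 h.2, fun h ↦ ?_⟩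
  have hy : y ∈ D := by
    have hnum : 0 < 1 + gaugeAt D x (x - y) := by
      linarith [gaugeAt_nonneg (D := D) (x := x) (x - y)]
    exact (gaugeAt_sub_lt_one_iff hDo hDc hx).1
      (sub_pos.1 (pos_of_mul_pos_right (hnum.trans_le h) (Real.exp_pos r).le))
  exact ⟨hy, (key hy).2 h⟩

theorem IsHilbertMetric.isCompact_closedBall
    {V : Type*} [NormedAddCommGroup V] [NormedSpace ℝ V] [FiniteDimensional ℝ V]
    {D : Set V} {d : V → V → ℝ} (hd : IsHilbertMetric D d) (hDo : IsOpen D) (hDc : Convex ℝ D)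
    (hDb : Bornology.IsBounded D) {x : V} (hx : x ∈ D) (r : ℝ) :
    IsCompact {y ∈ D | d x y ≤ r} := by
  have := FiniteDimensional.proper ℝ V
  refine Metric.isCompact_of_isClosed_isBounded ?_ (hDb.subset (Set.sep_subset _ _))
  rw [hd.closedBall_eq hDo hDc hx]
  have hg := continuous_gaugeAt hDo hDc hx
  exact isClosed_le (by fun_prop) (by fun_prop)

theorem hilbert_metric_proper
    {V : Type*} [NormedAddCommGroup V] [NormedSpace ℝ V] [FiniteDimensional ℝ V]
    (D : Set V) (hDo : IsOpen D) (hDc : Convex ℝ D) (hDb : Bornology.IsBounded D)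
    (hDn : D.Nonempty)
    (dH : V → V → ℝ) (hdH : IsHilbertMetric D dH) :
    -- every closed (in D) and dH-bounded subset of D is compact
    (∀ S : Set V, S ⊆ D → closure S ∩ D ⊆ S →
      (∃ C : ℝ, ∀ y ∈ S, ∀ z ∈ S, dH y z ≤ C) → IsCompact S) ∧
    -- equivalently, every closed ball of (D, dH) is compact
    (∀ x₀ ∈ D, ∀ r : ℝ, IsCompact {y ∈ D | dH x₀ y ≤ r}) := by
  have hball : ∀ x₀ ∈ D, ∀ r : ℝ, IsCompact {y ∈ D | dH x₀ y ≤ r} :=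
    fun x₀ hx₀ r ↦ hdH.isCompact_closedBall hDo hDc hDb hx₀ r
  refine ⟨?_, hball⟩
  rintro S hSD hScl ⟨C, hC⟩
  rcases S.eq_empty_or_nonempty with rfl | ⟨x, hxS⟩
  · exact isCompact_empty
  have hK := hball x (hSD hxS) C
  have hSK : S ⊆ {y ∈ D | dH x y ≤ C} := fun y hy ↦ ⟨hSD hy, hC x hxS y hy⟩
  have hcl : closure S ⊆ {y ∈ D | dH x y ≤ C} := closure_minimal hSK hK.isClosed
  exact hK.of_isClosed_subset
    (isClosed_of_closure_subset fun y hy ↦ hScl ⟨hy, (hcl hy).1⟩) hSK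
end

section
/- Let D be a nonempty bounded convex open subset of a finite-dimensional real normed vector space with Hilbert metric d_H. Then d_H satisfies condition (C): for all x, y, z ∈ D and s ∈ [0,1], d_H(s·x + (1−s)·y, z) ≤ max{d_H(x,z), d_H(y,z)}. -/
/-- If `x` lies on the segment from `a` to `z`, then `u ↦ c - F u`, when nonnegative at `a`,
decreases from `z` to `x` by at most the factor `‖x - a‖ / ‖z - a‖`. -/
theorem affine_mul_norm_le {V : Type*} [NormedAddCommGroup V] [NormedSpace ℝ V]
    (F : V →L[ℝ] ℝ) (c : ℝ) {a x z : V} (hx : x ∈ segment ℝ a z) (ha : 0 ≤ c - F a) :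
    (c - F z) * ‖x - a‖ ≤ (c - F x) * ‖z - a‖ := by
  obtain ⟨α, β, hα, hβ, hsum, rfl⟩ := hx
  have hsub : α • a + β • z - a = β • (z - a) := by
    rw [eq_sub_of_add_eq hsum]; module
  rw [hsub, norm_smul, Real.norm_of_nonneg hβ, map_add, map_smul, map_smul, smul_eq_mul,
    smul_eq_mul]
  have h : 0 ≤ α * (c - F a) * ‖z - a‖ := by positivity
  have hc : α = 1 - β := by linarith
  subst hc
  linarith

/-- If `x` lies on the segment from `a` to `z`, then `u ↦ c - F u`, when it vanishes at `a`,
scales from `z` to `x` by the factor `‖x - a‖ / ‖z - a‖`. -/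
theorem affine_mul_norm_eq {V : Type*} [NormedAddCommGroup V] [NormedSpace ℝ V]
    (F : V →L[ℝ] ℝ) {a x z : V} (hx : x ∈ segment ℝ a z) :
    (F a - F z) * ‖x - a‖ = (F a - F x) * ‖z - a‖ := by
  refine le_antisymm (affine_mul_norm_le F (F a) hx (by simp)) ?_
  have h := affine_mul_norm_le (-F) (-F a) hx (by simp)
  simp only [neg_apply] at h
  linarith

/-- A point of an open set differs from every point of the frontier. -/
theorem norm_sub_pos_of_mem_frontier {V : Type*} [NormedAddCommGroup V] {D : Set V}
    (hDo : IsOpen D) {x a : V} (hx : x ∈ D) (ha : a ∈ frontier D) : 0 < ‖x - a‖ := by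
  rw [norm_pos_iff, sub_ne_zero]
  rintro rfl
  rw [hDo.frontier_eq] at ha
  exact ha.2 hx

/-- The cross-ratio of two affine functions positive on `D` bounds the Hilbert metric from below. -/
theorem IsHilbertMetric.log_le {V : Type*} [NormedAddCommGroup V] [NormedSpace ℝ V]
    {D : Set V} (hDo : IsOpen D) {d : V → V → ℝ} (hd : IsHilbertMetric D d)
    (F G : V →L[ℝ] ℝ) (c e : ℝ) (hF : ∀ u ∈ D, F u < c) (hG : ∀ u ∈ D, G u < e)
    {x z : V} (hx : x ∈ D) (hz : z ∈ D) :
    Real.log (((c - F z) * (e - G x)) / ((c - F x) * (e - G z))) ≤ d x z := by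
  have hFx := sub_pos.2 (hF x hx)
  have hFz := sub_pos.2 (hF z hz)
  have hGx := sub_pos.2 (hG x hx)
  have hGz := sub_pos.2 (hG z hz)
  by_cases hxz : x = z
  · subst hxz
    rw [div_self (by positivity), Real.log_one, hd.1 x hx]
  obtain ⟨a, ha, b, hb, hxa, hzb, h⟩ := hd.2 x hx z hz hxz
  have closure_nonneg : ∀ (H : V →L[ℝ] ℝ) (k : ℝ), (∀ u ∈ D, H u < k) →
      ∀ u ∈ frontier D, 0 ≤ k - H u := fun H k hH u hu =>
    sub_nonneg.2 (closure_minimal (fun v hv => (hH v hv).le)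
      (isClosed_le H.continuous continuous_const) (frontier_subset_closure hu))
  have h₁ := affine_mul_norm_le F c hxa (closure_nonneg F c hF a ha)
  rw [segment_symm] at hzb
  have h₂ := affine_mul_norm_le G e hzb (closure_nonneg G e hG b hb)
  have hxa' := norm_sub_pos_of_mem_frontier hDo hx ha
  have hzb' := norm_sub_pos_of_mem_frontier hDo hz hb
  rw [h]
  refine Real.log_le_log (by positivity) ?_
  rw [div_le_div_iff₀ (by positivity) (by positivity)]
  have := mul_le_mul h₁ h₂ (by positivity) (by positivity)
  linarith

/-- The Hilbert metric is attained as the cross-ratio of two affine functions positive on `D`. -/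
theorem IsHilbertMetric.exists_eq_log {V : Type*} [NormedAddCommGroup V] [NormedSpace ℝ V]
    {D : Set V} (hDo : IsOpen D) (hDc : Convex ℝ D) {d : V → V → ℝ} (hd : IsHilbertMetric D d)
    {x z : V} (hx : x ∈ D) (hz : z ∈ D) (hxz : x ≠ z) :
    ∃ (F G : V →L[ℝ] ℝ) (c e : ℝ), (∀ u ∈ D, F u < c) ∧ (∀ u ∈ D, G u < e) ∧
      d x z = Real.log (((c - F z) * (e - G x)) / ((c - F x) * (e - G z))) := by
  obtain ⟨a, ha, b, hb, hxa, hzb, h⟩ := hd.2 x hx z hz hxz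
  have notMem : ∀ u ∈ frontier D, u ∉ D := fun u hu => (hDo.frontier_eq ▸ hu).2
  obtain ⟨F, hF⟩ := geometric_hahn_banach_open_point hDc hDo (notMem a ha)
  obtain ⟨G, hG⟩ := geometric_hahn_banach_open_point hDc hDo (notMem b hb)
  refine ⟨F, G, F a, G b, hF, hG, ?_⟩
  have hFx := sub_pos.2 (hF x hx)
  have hGz := sub_pos.2 (hG z hz)
  have h₁ := affine_mul_norm_eq F hxa
  rw [segment_symm] at hzb
  have h₂ := affine_mul_norm_eq G hzb
  have hxa' := norm_sub_pos_of_mem_frontier hDo hx ha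
  have hzb' := norm_sub_pos_of_mem_frontier hDo hz hb
  rw [h]
  congr 1
  rw [div_eq_div_iff (by positivity) (by positivity)]
  linear_combination (-(G b - G x) * ‖z - b‖) * h₁ - ((F a - F x) * ‖z - a‖) * h₂

theorem hilbert_metric_condition_C
    {V : Type*} [NormedAddCommGroup V] [NormedSpace ℝ V] [FiniteDimensional ℝ V]
    (D : Set V) (hDo : IsOpen D) (hDc : Convex ℝ D) (hDb : Bornology.IsBounded D)
    (hDn : D.Nonempty)
    (dH : V → V → ℝ) (hdH : IsHilbertMetric D dH) :
    ∀ x ∈ D, ∀ y ∈ D, ∀ z ∈ D, ∀ s ∈ Set.Icc (0 : ℝ) 1,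
      dH (s • x + (1 - s) • y) z ≤ max (dH x z) (dH y z) := by
  intro x hx y hy z hz s hs
  have hs' : 0 ≤ 1 - s := sub_nonneg.2 hs.2
  have hw : s • x + (1 - s) • y ∈ D := hDc hx hy hs.1 hs' (by ring)
  by_cases hwz : s • x + (1 - s) • y = z
  · rw [hwz, hdH.1 z hz]
    have h := hdH.log_le hDo 0 0 1 1 (by simp) (by simp) hx hz
    exact le_max_of_le_left (by simpa using h)
  obtain ⟨F, G, c, e, hF, hG, h⟩ := hdH.exists_eq_log hDo hDc hw hz hwz
  have hFx := sub_pos.2 (hF x hx)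
  have hFy := sub_pos.2 (hF y hy)
  have hFz := sub_pos.2 (hF z hz)
  have hGz := sub_pos.2 (hG z hz)
  have hFw := sub_pos.2 (hF _ hw)
  have hGw := sub_pos.2 (hG _ hw)
  set R := ((c - F z) * (e - G (s • x + (1 - s) • y))) /
    ((c - F (s • x + (1 - s) • y)) * (e - G z)) with hR
  have hRpos : 0 < R := by positivity
  have reduce : ∀ u ∈ D, R * ((c - F u) * (e - G z)) ≤ (c - F z) * (e - G u) →
      dH (s • x + (1 - s) • y) z ≤ dH u z := by
    intro u hu hle
    have hFu := sub_pos.2 (hF u hu)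
    rw [h]
    exact (Real.log_le_log hRpos ((le_div_iff₀ (by positivity)).2 hle)).trans
      (hdH.log_le hDo F G c e hF hG hu hz)
  by_cases hxR : R * ((c - F x) * (e - G z)) ≤ (c - F z) * (e - G x)
  · exact le_max_of_le_left (reduce x hx hxR)
  by_cases hyR : R * ((c - F y) * (e - G z)) ≤ (c - F z) * (e - G y)
  · exact le_max_of_le_right (reduce y hy hyR)
  exfalso
  push Not at hxR hyR
  have hReq : R * ((c - F (s • x + (1 - s) • y)) * (e - G z)) =
      (c - F z) * (e - G (s • x + (1 - s) • y)) := div_mul_cancel₀ _ (by positivity)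
  simp only [map_add, map_smul, smul_eq_mul] at hReq
  rcases hs.1.eq_or_lt with h0 | h0
  · rw [← h0] at hReq
    linarith
  · have h₁ := mul_lt_mul_of_pos_left hxR h0
    have h₂ := mul_le_mul_of_nonneg_left hyR.le hs'
    linarith
end

section
/- Let D be a nonempty bounded convex open subset of a finite-dimensional real normed vector space V, let F : D → D be any map, x ∈ D and λ > 0. Define G_{x,λ} : D → D by G_{x,λ}(y) = (1/(1+λ))·x + (λ/(1+λ))·F(y). Then for every w ∈ G_{x,λ}(D), the Euclidean distance from w to the boundary satisfies inf_{v ∈ ∂D} ‖v − w‖ ≥ (1/(1+λ))·inf_{v ∈ ∂D} ‖v − x‖; consequently the closure of G_{x,λ}(D) is a compact subset of D. -/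
/-- A preconnected set meeting both `s` and its complement meets `frontier s`. -/
theorem IsPreconnected.inter_frontier_nonempty {X : Type*} [TopologicalSpace X] {t s : Set X}
    (ht : IsPreconnected t) (hs : (t ∩ s).Nonempty) (hsc : (t ∩ sᶜ).Nonempty) :
    (t ∩ frontier s).Nonempty := by
  by_contra hne
  have hf : ∀ y ∈ t, y ∈ closure s → y ∈ interior s := fun y hy hyc => by
    by_contra hyi
    exact hne ⟨y, hy, hyc, hyi⟩
  obtain ⟨y, hy, hys⟩ := hs
  obtain ⟨z, hz, hzs⟩ := hsc
  obtain ⟨w, -, hwi, hwc⟩ := ht (interior s) (closure s)ᶜ isOpen_interior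
    isClosed_closure.isOpen_compl (fun w hw => or_iff_not_imp_right.2 fun h => hf w hw (not_not.1 h))
    ⟨y, hy, hf y hy (subset_closure hys)⟩
    ⟨z, hz, fun h => hzs (interior_subset (hf z hz h))⟩
  exact hwc (subset_closure (interior_subset hwi))

/-- Every point closer to `x ∈ s` than all of `frontier s` belongs to `s`. -/
theorem mem_of_norm_sub_lt_sInf_frontier {V : Type*} [NormedAddCommGroup V] [NormedSpace ℝ V]
    {s : Set V} {x p : V} (hx : x ∈ s)
    (hp : ‖p - x‖ < sInf ((fun v => ‖v - x‖) '' frontier s)) : p ∈ s := by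
  by_contra hps
  obtain ⟨v, hv, hvs⟩ := (convex_segment (𝕜 := ℝ) x p).isPreconnected.inter_frontier_nonempty
    ⟨x, left_mem_segment ℝ x p, hx⟩ ⟨p, right_mem_segment ℝ x p, hps⟩
  have hle : sInf ((fun v => ‖v - x‖) '' frontier s) ≤ ‖v - x‖ :=
    csInf_le ⟨0, by rintro _ ⟨u, -, rfl⟩; exact norm_nonneg _⟩ ⟨v, hvs, rfl⟩
  exact (hle.trans (norm_sub_le_of_mem_segment hv)).not_gt hp

/-- A convex combination `a • x + b • z` of points of a convex open set is at distance at least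
`a` times that of `x` from the boundary. -/
theorem mul_sInf_frontier_le_of_convex_combination {V : Type*} [NormedAddCommGroup V]
    [NormedSpace ℝ V] {s : Set V} (hso : IsOpen s) (hsc : Convex ℝ s) {x z : V}
    (hx : x ∈ s) (hz : z ∈ s) {a b : ℝ} (ha : 0 < a) (hb : 0 ≤ b) (hab : a + b = 1) :
    a * sInf ((fun v => ‖v - x‖) '' frontier s) ≤
      sInf ((fun v => ‖v - (a • x + b • z)‖) '' frontier s) := by
  rcases (frontier s).eq_empty_or_nonempty with he | hne
  · simp [he]
  refine le_csInf (hne.image _) ?_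
  rintro _ ⟨v, hv, rfl⟩
  by_contra! hlt
  have hp : x + a⁻¹ • (v - (a • x + b • z)) ∈ s := by
    apply mem_of_norm_sub_lt_sInf_frontier hx
    rwa [add_sub_cancel_left, norm_smul, norm_inv, Real.norm_of_nonneg ha.le,
      inv_mul_lt_iff₀ ha]
  have hvs := hsc hp hz ha.le hb hab
  rw [smul_add, smul_inv_smul₀ ha.ne', add_right_comm, add_sub_cancel] at hvs
  exact (hso.frontier_eq ▸ hv).2 hvs


theorem resolvent_auxiliary_map_image_away_from_boundary
    {V : Type*} [NormedAddCommGroup V] [NormedSpace ℝ V] [FiniteDimensional ℝ V]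
    (D : Set V) (hDo : IsOpen D) (hDc : Convex ℝ D) (hDb : Bornology.IsBounded D)
    (hDn : D.Nonempty)
    (F : V → V) (hF : ∀ y ∈ D, F y ∈ D)
    (x : V) (hx : x ∈ D) (lam : ℝ) (hlam : 0 < lam) :
    (∀ y ∈ D,
      (1 / (1 + lam)) * sInf ((fun v => ‖v - x‖) '' frontier D) ≤
        sInf ((fun v => ‖v - ((1 / (1 + lam)) • x + (lam / (1 + lam)) • F y)‖) ''
          frontier D)) ∧
    IsCompact (closure ((fun y => (1 / (1 + lam)) • x + (lam / (1 + lam)) • F y) '' D)) ∧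
    closure ((fun y => (1 / (1 + lam)) • x + (lam / (1 + lam)) • F y) '' D) ⊆ D := by
  have ha : 0 < 1 / (1 + lam) := by positivity
  have hb : 0 ≤ lam / (1 + lam) := by positivity
  have hab : 1 / (1 + lam) + lam / (1 + lam) = 1 := by field_simp
  refine ⟨fun y hy => mul_sInf_frontier_le_of_convex_combination hDo hDc hx (hF y hy) ha hb hab,
    (hDb.subset ?_).isCompact_closure, ?_⟩
  · rintro _ ⟨y, hy, rfl⟩
    exact hDc hx (hF y hy) ha.le hb hab
  have hK : IsCompact ((fun z => (1 / (1 + lam)) • x + (lam / (1 + lam)) • z) '' closure D) :=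
    hDb.isCompact_closure.image (by fun_prop)
  refine (closure_minimal ?_ hK.isClosed).trans ?_
  · rintro _ ⟨y, hy, rfl⟩
    exact ⟨F y, subset_closure (hF y hy), rfl⟩
  · rintro _ ⟨z, hz, rfl⟩
    exact interior_subset
      (hDc.combo_interior_closure_mem_interior (hDo.interior_eq.symm ▸ hx) hz ha hb hab)
end

section
/- Let D be a nonempty bounded convex open subset of a finite-dimensional real normed vector space with Hilbert metric d_H, let F : D → D be nonexpansive with respect to d_H, let x ∈ D and λ > 0, and define G_{x,λ}(y) = (1/(1+λ))·x + (λ/(1+λ))·F(y) for y ∈ D. Then G_{x,λ} has a unique fixed point z ∈ D, i.e., a unique z with z = (1/(1+λ))·x + (λ/(1+λ))·F(z), and for every y ∈ D the iterates G_{x,λ}ⁿ(y) converge to z in d_H as n → ∞. -/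
theorem notMem_of_mem_frontier_of_isOpen {X : Type*} [TopologicalSpace X] {D : Set X}
    (hDo : IsOpen D) {a : X} (ha : a ∈ frontier D) : a ∉ D := by
  rw [hDo.frontier_eq] at ha
  exact ha.2

section HilbertMetric

variable {V : Type*} [NormedAddCommGroup V] [NormedSpace ℝ V] {D : Set V} {d : V → V → ℝ}

theorem exists_pos_eq_sub_smul_of_mem_segment {a x y : V} (h : x ∈ segment ℝ a y)
    (hxa : x ≠ a) (hxy : x ≠ y) : ∃ p : ℝ, 0 < p ∧ a = x - p • (y - x) := by
  obtain ⟨α, β, hα, hβ, hαβ, rfl⟩ := h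
  have hα' : α ≠ 0 := by
    rintro rfl
    apply hxy
    simp at hαβ
    simp [hαβ]
  have hβ' : β ≠ 0 := by
    rintro rfl
    apply hxa
    simp at hαβ
    simp [hαβ]
  refine ⟨β / α, div_pos (lt_of_le_of_ne hβ hβ'.symm) (lt_of_le_of_ne hα hα'.symm), ?_⟩
  obtain rfl : β = 1 - α := by linarith
  match_scalars <;> field_simp <;> ring

/-- The Hilbert distance in terms of the positions of the two boundary points on the line. -/
theorem IsHilbertMetric.exists_eq_log_s7 (hd : IsHilbertMetric D d) (hDo : IsOpen D)
    {x y : V} (hx : x ∈ D) (hy : y ∈ D) (hxy : x ≠ y) :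
    ∃ p q : ℝ, 0 < p ∧ 0 < q ∧ x - p • (y - x) ∈ frontier D ∧ y - q • (x - y) ∈ frontier D ∧
      d x y = -Real.log (p / (1 + p)) + -Real.log (q / (1 + q)) := by
  obtain ⟨a, ha, b, hb, hax, hby, hdxy⟩ := hd.2 x hx y hy hxy
  obtain ⟨p, hp, rfl⟩ := exists_pos_eq_sub_smul_of_mem_segment hax
    (fun h => notMem_of_mem_frontier_of_isOpen hDo ha (h ▸ hx)) hxy
  obtain ⟨q, hq, rfl⟩ := exists_pos_eq_sub_smul_of_mem_segment
    (show y ∈ segment ℝ b x by rwa [segment_symm])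
    (fun h => notMem_of_mem_frontier_of_isOpen hDo hb (h ▸ hy)) hxy.symm
  refine ⟨p, q, hp, hq, ha, hb, ?_⟩
  have hu : 0 < ‖y - x‖ := norm_pos_iff.2 (sub_ne_zero.2 hxy.symm)
  have e1 : y - (x - p • (y - x)) = (1 + p) • (y - x) := by module
  have e2 : x - (y - q • (x - y)) = -((1 + q) • (y - x)) := by module
  have e3 : x - (x - p • (y - x)) = p • (y - x) := by module
  have e4 : y - (y - q • (x - y)) = -(q • (y - x)) := by module
  rw [hdxy, e1, e2, e3, e4, norm_neg, norm_neg, norm_smul, norm_smul, norm_smul, norm_smul,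
    Real.norm_of_nonneg hp.le, Real.norm_of_nonneg hq.le, Real.norm_of_nonneg (by linarith),
    Real.norm_of_nonneg (by linarith), ← neg_add,
    ← Real.log_mul (by positivity) (by positivity), ← Real.log_inv]
  congr 1
  field_simp

theorem lt_of_sub_smul_mem (hDo : IsOpen D) (hDc : Convex ℝ D) {x u : V} {p t : ℝ}
    (hx : x ∈ D) (hp : 0 < p) (hpD : x - p • u ∈ frontier D) (ht : x - t • u ∈ D) : t < p := by
  by_contra! h
  refine notMem_of_mem_frontier_of_isOpen hDo hpD ?_
  have ht0 : 0 < t := hp.trans_le h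
  have e : x - p • u = (1 - p / t) • x + (p / t) • (x - t • u) := by
    match_scalars <;> field_simp
    ring
  rw [e]
  exact hDc hx ht (sub_nonneg.2 ((div_le_one ht0).2 h)) (by positivity) (by ring)

theorem neg_log_div_one_add_le {t p : ℝ} (ht : 0 < t) (htp : t ≤ p) :
    -Real.log (p / (1 + p)) ≤ -Real.log (t / (1 + t)) := by
  refine neg_le_neg (Real.log_le_log (by positivity) ?_)
  rw [div_le_div_iff₀ (by linarith) (by linarith)]
  nlinarith

theorem neg_log_div_one_add_shift_le {p κ : ℝ} (hp : 0 < p) (hκ : 0 < κ) :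
    -Real.log ((p + κ * (1 + p)) / (1 + (p + κ * (1 + p)))) ≤
      1 / (1 + κ) * -Real.log (p / (1 + p)) := by
  have h := strictConcaveOn_log_Ioi.concaveOn.2
    (Set.mem_Ioi.2 (show 0 < p / (1 + p) by positivity)) (Set.mem_Ioi.2 one_pos)
    (show 0 ≤ 1 / (1 + κ) by positivity) (show 0 ≤ κ / (1 + κ) by positivity) (by field_simp)
  simp only [smul_eq_mul, Real.log_one, mul_zero, add_zero, mul_one] at h
  have e : (p + κ * (1 + p)) / (1 + (p + κ * (1 + p))) =
      1 / (1 + κ) * (p / (1 + p)) + κ / (1 + κ) := by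
    field_simp
    ring
  rw [e]
  linarith

theorem norm_sub_div_le_neg_log {x y : V} {p M : ℝ} (hp : 0 < p) (hM : 0 < M)
    (h : ‖y - (x - p • (y - x))‖ ≤ M) : ‖x - y‖ / M ≤ -Real.log (p / (1 + p)) := by
  have e : y - (x - p • (y - x)) = (1 + p) • (y - x) := by module
  rw [e, norm_smul, Real.norm_of_nonneg (by linarith), norm_sub_rev] at h
  have h1 := Real.log_le_sub_one_of_pos (show 0 < p / (1 + p) by positivity)
  have h2 : ‖x - y‖ / M ≤ 1 - p / (1 + p) := by
    rw [one_sub_div (by positivity), add_sub_cancel_right, div_le_div_iff₀ hM (by positivity)]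
    linarith
  linarith

/-- The Hilbert metric dominates a multiple of the norm distance. -/
theorem IsHilbertMetric.norm_sub_le (hd : IsHilbertMetric D d) (hDo : IsOpen D) {M : ℝ}
    (hM : 0 < M) (hDM : ∀ a ∈ closure D, ∀ b ∈ closure D, ‖a - b‖ ≤ M)
    {x y : V} (hx : x ∈ D) (hy : y ∈ D) : ‖x - y‖ ≤ M * d x y := by
  rcases eq_or_ne x y with rfl | hxy
  · simp [hd.1 x hx]
  obtain ⟨p, q, hp, hq, ha, hb, h⟩ := hd.exists_eq_log_s7 hDo hx hy hxy
  have h1 := norm_sub_div_le_neg_log hp hM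
    (hDM _ (subset_closure hy) _ (frontier_subset_closure ha))
  have h2 := norm_sub_div_le_neg_log hq hM
    (hDM _ (subset_closure hx) _ (frontier_subset_closure hb))
  have h3 : 0 ≤ ‖y - x‖ / M := by positivity
  have h4 : ‖x - y‖ / M ≤ d x y := by linarith
  rwa [div_le_iff₀' hM] at h4

theorem neg_log_le_of_ball_subset (hDo : IsOpen D) (hDc : Convex ℝ D) {x u : V} {p r : ℝ}
    (hr : 0 < r) (hball : Metric.ball x r ⊆ D) (hu : u ≠ 0) (hp : 0 < p)
    (hpD : x - p • u ∈ frontier D) : -Real.log (p / (1 + p)) ≤ 2 / r * ‖u‖ := by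
  have hu' : 0 < ‖u‖ := norm_pos_iff.2 hu
  have hlt : r / (2 * ‖u‖) < p := by
    refine lt_of_sub_smul_mem hDo hDc (hball (Metric.mem_ball_self hr)) hp hpD (hball ?_)
    rw [mem_ball_iff_norm, sub_sub_cancel_left, norm_neg, norm_smul,
      Real.norm_of_nonneg (by positivity)]
    field_simp
    linarith
  have h1 := Real.log_le_sub_one_of_pos (show 0 < (p / (1 + p))⁻¹ by positivity)
  rw [Real.log_inv] at h1
  have h2 : (p / (1 + p))⁻¹ - 1 = 1 / p := by
    field_simp
    ring
  have h3 : 1 / p ≤ 1 / (r / (2 * ‖u‖)) := one_div_le_one_div_of_le (by positivity) hlt.le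
  have h4 : 1 / (r / (2 * ‖u‖)) = 2 / r * ‖u‖ := by field_simp
  linarith

/-- Near a given point, the Hilbert metric is dominated by a multiple of the norm distance. -/
theorem IsHilbertMetric.le_norm_sub (hd : IsHilbertMetric D d) (hDo : IsOpen D)
    (hDc : Convex ℝ D) {x y : V} {r : ℝ} (hr : 0 < r) (hx : Metric.ball x r ⊆ D)
    (hy : Metric.ball y r ⊆ D) : d x y ≤ 4 / r * ‖x - y‖ := by
  have hxD := hx (Metric.mem_ball_self hr)
  have hyD := hy (Metric.mem_ball_self hr)
  rcases eq_or_ne x y with rfl | hxy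
  · simp [hd.1 x hxD]
  obtain ⟨p, q, hp, hq, ha, hb, h⟩ := hd.exists_eq_log_s7 hDo hxD hyD hxy
  have h1 := neg_log_le_of_ball_subset hDo hDc hr hx (sub_ne_zero.2 hxy.symm) hp ha
  have h2 := neg_log_le_of_ball_subset hDo hDc hr hy (sub_ne_zero.2 hxy) hq hb
  rw [norm_sub_rev] at h1
  have e : 4 / r * ‖x - y‖ = 2 / r * ‖x - y‖ + 2 / r * ‖x - y‖ := by ring
  linarith

theorem neg_log_combo_le (hDo : IsOpen D) (hDc : Convex ℝ D) {M r κ c s p p' : ℝ} {x w w' : V}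
    (hr : Metric.ball x r ⊆ D) (hDM : ∀ a ∈ closure D, ∀ b ∈ closure D, ‖a - b‖ ≤ M)
    (hc : 0 < c) (hs : 0 < s) (hcs : c + s = 1) (hκ : 0 < κ) (hκM : κ * s * M < c * r)
    (hx : x ∈ D) (hw : w ∈ D) (hw' : w' ∈ D) (hp : 0 < p) (hp' : 0 < p')
    (hpD : w - p • (w' - w) ∈ frontier D)
    (hpD' : (c • x + s • w) - p' • ((c • x + s • w') - (c • x + s • w)) ∈ frontier D) :
    -Real.log (p' / (1 + p')) ≤ 1 / (1 + κ) * -Real.log (p / (1 + p)) := by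
  refine le_trans (neg_log_div_one_add_le (by positivity) (le_of_lt ?_))
    (neg_log_div_one_add_shift_le hp hκ)
  refine lt_of_sub_smul_mem hDo hDc (hDc hx hw hc.le hs.le hcs) hp' hpD' ?_
  set v : V := x - (κ * s / c) • (w' - (w - p • (w' - w))) with hv
  have hvD : v ∈ D := by
    refine hr ?_
    have h := hDM _ (subset_closure hw') _ (frontier_subset_closure hpD)
    rw [mem_ball_iff_norm, hv, sub_sub_cancel_left, norm_neg, norm_smul,
      Real.norm_of_nonneg (by positivity)]
    calc κ * s / c * ‖w' - (w - p • (w' - w))‖ ≤ κ * s / c * M := by gcongr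
      _ = κ * s * M / c := by ring
      _ < r := by rwa [div_lt_iff₀' hc]
  have e : (c • x + s • w) - (p + κ * (1 + p)) • ((c • x + s • w') - (c • x + s • w)) =
      s • (w - p • (w' - w)) + c • v := by
    rw [hv]
    match_scalars <;> field_simp <;> ring
  rw [e]
  exact interior_subset (hDc.combo_closure_interior_mem_interior (frontier_subset_closure hpD)
    (by rwa [hDo.interior_eq]) hs.le hc (by linarith))

/-- Homotheties of positive ratio less than one, centred at a point of a bounded convex open set,
are strict contractions of its Hilbert metric. -/
theorem IsHilbertMetric.exists_combo_contraction (hd : IsHilbertMetric D d) (hDo : IsOpen D)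
    (hDc : Convex ℝ D) {M : ℝ} (hM : 0 < M)
    (hDM : ∀ a ∈ closure D, ∀ b ∈ closure D, ‖a - b‖ ≤ M) {x : V} (hx : x ∈ D) {c s : ℝ}
    (hc : 0 < c) (hs : 0 < s) (hcs : c + s = 1) :
    ∃ k : ℝ, 0 ≤ k ∧ k < 1 ∧ ∀ w ∈ D, ∀ w' ∈ D,
      d (c • x + s • w) (c • x + s • w') ≤ k * d w w' := by
  obtain ⟨r, hr, hball⟩ := Metric.isOpen_iff.1 hDo x hx
  have hκ : 0 < c * r / (2 * s * M) := by positivity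
  have hκM : c * r / (2 * s * M) * s * M < c * r := by
    have : 0 < c * r := by positivity
    field_simp
    linarith
  set κ := c * r / (2 * s * M)
  refine ⟨1 / (1 + κ), by positivity, (div_lt_one (by positivity)).2 (by linarith), ?_⟩
  intro w hw w' hw'
  have hA : ∀ w ∈ D, c • x + s • w ∈ D := fun w hw => hDc hx hw hc.le hs.le hcs
  rcases eq_or_ne w w' with rfl | hne
  · simp [hd.1 w hw, hd.1 _ (hA w hw)]
  have hne' : c • x + s • w ≠ c • x + s • w' := by
    simpa [hs.ne'] using hne
  obtain ⟨p, q, hp, hq, ha, hb, h⟩ := hd.exists_eq_log_s7 hDo hw hw' hne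
  obtain ⟨p', q', hp', hq', ha', hb', h'⟩ :=
    hd.exists_eq_log_s7 hDo (hA w hw) (hA w' hw') hne'
  rw [h, h', mul_add]
  exact add_le_add
    (neg_log_combo_le hDo hDc hball hDM hc hs hcs hκ hκM hx hw hw' hp hp' ha ha')
    (neg_log_combo_le hDo hDc hball hDM hc hs hcs hκ hκM hx hw' hw hq hq' hb hb')

theorem IsHilbertMetric.tendsto_of_tendsto (hd : IsHilbertMetric D d) (hDo : IsOpen D)
    (hDc : Convex ℝ D) {M : ℝ} (hM : 0 < M)
    (hDM : ∀ a ∈ closure D, ∀ b ∈ closure D, ‖a - b‖ ≤ M) {y : ℕ → V} (hy : ∀ n, y n ∈ D) {z : V}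
    (hz : z ∈ D) (hyz : Filter.Tendsto y Filter.atTop (nhds z)) :
    Filter.Tendsto (fun n => d (y n) z) Filter.atTop (nhds 0) := by
  obtain ⟨r, hr, hball⟩ := Metric.isOpen_iff.1 hDo z hz
  have hlim : Filter.Tendsto (fun n => 4 / (r / 2) * ‖y n - z‖) Filter.atTop (nhds 0) := by
    simpa using (tendsto_iff_norm_sub_tendsto_zero.1 hyz).const_mul (4 / (r / 2))
  refine squeeze_zero' (Filter.Eventually.of_forall fun n => ?_) ?_ hlim
  · exact nonneg_of_mul_nonneg_right
      ((norm_nonneg _).trans (hd.norm_sub_le hDo hM hDM (hy n) hz)) hM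
  · filter_upwards [hyz.eventually (Metric.ball_mem_nhds z (half_pos hr))] with n hn
    refine hd.le_norm_sub hDo hDc (half_pos hr) ?_
      ((Metric.ball_subset_ball (by linarith)).trans hball)
    refine (Metric.ball_subset_ball' ?_).trans hball
    have := Metric.mem_ball.1 hn
    linarith

end HilbertMetric

theorem resolvent_exists_unique_fixed_point_and_iterates_converge
    {V : Type*} [NormedAddCommGroup V] [NormedSpace ℝ V] [FiniteDimensional ℝ V]
    (D : Set V) (hDo : IsOpen D) (hDc : Convex ℝ D) (hDb : Bornology.IsBounded D)
    (hDn : D.Nonempty)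
    (dH : V → V → ℝ) (hdH : IsHilbertMetric D dH)
    (F : V → V) (hFmaps : ∀ y ∈ D, F y ∈ D)
    (hFne : ∀ x ∈ D, ∀ y ∈ D, dH (F x) (F y) ≤ dH x y)
    (x : V) (hx : x ∈ D) (lam : ℝ) (hlam : 0 < lam) :
    ∃ z ∈ D, z = (1 / (1 + lam)) • x + (lam / (1 + lam)) • F z ∧
      (∀ z' ∈ D, z' = (1 / (1 + lam)) • x + (lam / (1 + lam)) • F z' → z' = z) ∧
      ∀ y ∈ D, Filter.Tendsto
        (fun n => dH ((fun w => (1 / (1 + lam)) • x + (lam / (1 + lam)) • F w)^[n] y) z)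
        Filter.atTop (nhds 0) := by
  have hc : 0 < 1 / (1 + lam) := by positivity
  have hs : 0 < lam / (1 + lam) := by positivity
  have hcs : 1 / (1 + lam) + lam / (1 + lam) = 1 := by field_simp
  generalize 1 / (1 + lam) = c at *
  generalize lam / (1 + lam) = s at *
  obtain ⟨M, hM, hDM⟩ : ∃ M : ℝ, 0 < M ∧ ∀ a ∈ closure D, ∀ b ∈ closure D, ‖a - b‖ ≤ M := by
    obtain ⟨C, hC⟩ := Metric.isBounded_iff.1 hDb.closure
    refine ⟨max C 1, by positivity, fun a ha b hb => ?_⟩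
    rw [← dist_eq_norm]
    exact (hC ha hb).trans (le_max_left _ _)
  obtain ⟨k, hk0, hk1, hk⟩ := hdH.exists_combo_contraction hDo hDc hM hDM hx hc hs hcs
  set G : V → V := fun w => c • x + s • F w with hG
  have hGmaps : ∀ y ∈ D, G y ∈ D := fun y hy => hDc hx (hFmaps y hy) hc.le hs.le hcs
  have hGk : ∀ y ∈ D, ∀ y' ∈ D, dH (G y) (G y') ≤ k * dH y y' := fun y hy y' hy' =>
    (hk _ (hFmaps y hy) _ (hFmaps y' hy')).trans
      (mul_le_mul_of_nonneg_left (hFne y hy y' hy') hk0)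
  have hnorm : ∀ y ∈ D, ∀ y' ∈ D, ‖y - y'‖ ≤ M * dH y y' := fun y hy y' hy' =>
    hdH.norm_sub_le hDo hM hDM hy hy'
  have hnonneg : ∀ y ∈ D, ∀ y' ∈ D, 0 ≤ dH y y' := fun y hy y' hy' =>
    nonneg_of_mul_nonneg_right ((norm_nonneg _).trans (hnorm y hy y' hy')) hM
  have hiter : ∀ y ∈ D, ∀ n, G^[n] y ∈ D := by
    intro y hy n
    induction n with
    | zero => exact hy
    | succ n ih =>
      rw [Function.iterate_succ_apply']
      exact hGmaps _ ih
  have hiterk : ∀ y ∈ D, ∀ y' ∈ D, ∀ n, dH (G^[n] y) (G^[n] y') ≤ k ^ n * dH y y' := by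
    intro y hy y' hy' n
    induction n with
    | zero => simp
    | succ n ih =>
      rw [Function.iterate_succ_apply', Function.iterate_succ_apply', pow_succ', mul_assoc]
      exact (hGk _ (hiter y hy n) _ (hiter y' hy' n)).trans (mul_le_mul_of_nonneg_left ih hk0)
  have hcauchy : CauchySeq fun n => G^[n] x := by
    refine cauchySeq_of_le_geometric k (M * dH x (G x)) hk1 fun n => ?_
    rw [dist_eq_norm, Function.iterate_succ_apply]
    calc _ ≤ M * dH (G^[n] x) (G^[n] (G x)) :=
          hnorm _ (hiter x hx n) _ (hiter _ (hGmaps x hx) n)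
      _ ≤ M * (k ^ n * dH x (G x)) :=
          mul_le_mul_of_nonneg_left (hiterk x hx _ (hGmaps x hx) n) hM.le
      _ = M * dH x (G x) * k ^ n := by ring
  have : CompleteSpace V := FiniteDimensional.complete ℝ V
  obtain ⟨z, hz⟩ := cauchySeq_tendsto_of_complete hcauchy
  have hz1 : Filter.Tendsto (fun n => G (G^[n] x)) Filter.atTop (nhds z) :=
    (hz.comp (Filter.tendsto_add_atTop_nat 1)).congr fun n => Function.iterate_succ_apply' G n x
  have hzD : z ∈ D := by
    have hv : Filter.Tendsto (fun n => F (G^[n] x)) Filter.atTop (nhds (s⁻¹ • (z - c • x))) := by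
      refine ((hz1.sub_const (c • x)).const_smul s⁻¹).congr fun n => ?_
      simp [hG, smul_smul, hs.ne']
    have hvD : s⁻¹ • (z - c • x) ∈ closure D :=
      mem_closure_of_tendsto hv (Filter.Eventually.of_forall fun n => hFmaps _ (hiter x hx n))
    have e : z = s • (s⁻¹ • (z - c • x)) + c • x := by
      rw [smul_smul, mul_inv_cancel₀ hs.ne', one_smul, sub_add_cancel]
    rw [e]
    exact interior_subset (hDc.combo_closure_interior_mem_interior hvD
      (by rwa [hDo.interior_eq]) hs.le hc (by linarith))
  have hfix : z = G z := by
    refine tendsto_nhds_unique hz1 (tendsto_iff_norm_sub_tendsto_zero.2 ?_)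
    have hlim := (hdH.tendsto_of_tendsto hDo hDc hM hDM (hiter x hx) hzD hz).const_mul (M * k)
    rw [mul_zero] at hlim
    refine squeeze_zero (fun n => norm_nonneg _) (fun n => ?_) hlim
    rw [mul_assoc]
    exact (hnorm _ (hGmaps _ (hiter x hx n)) _ (hGmaps z hzD)).trans
      (mul_le_mul_of_nonneg_left (hGk _ (hiter x hx n) z hzD) hM.le)
  refine ⟨z, hzD, hfix, fun z' hz' hfix' => ?_, fun y hy => ?_⟩
  · have h1 : dH z' z ≤ k * dH z' z := by
      have h := hGk z' hz' z hzD
      rwa [← hfix, show G z' = z' from hfix'.symm] at h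
    have h2 : dH z' z = 0 := by nlinarith [hnonneg z' hz' z hzD]
    have h3 := hnorm z' hz' z hzD
    rw [h2, mul_zero] at h3
    exact sub_eq_zero.1 (norm_le_zero_iff.1 h3)
  · have hlim := (tendsto_pow_atTop_nhds_zero_of_lt_one hk0 hk1).mul_const (dH y z)
    rw [zero_mul] at hlim
    refine squeeze_zero (fun n => hnonneg _ (hiter y hy n) z hzD) (fun n => ?_) hlim
    have h := hiterk y hy z hzD n
    rwa [Function.iterate_fixed hfix.symm] at h
end

section
/- Let D be a nonempty bounded convex open subset of a finite-dimensional real normed vector space with Hilbert metric d_H and let F : D → D be nonexpansive with respect to d_H. Then the resolvents of F satisfy the resolvent identity: for all λ > μ > 0 and all x ∈ D, R_λ(x) = R_μ( ((λ−μ)/λ)·R_λ(x) + (μ/λ)·x ). -/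
/-- A point `x` lying on the segment from `a` to `y` and distinct from both endpoints is obtained
by prolonging the segment from `y` to `x` beyond `x` by a positive ratio to reach `a`. -/
theorem exists_pos_prolongation_of_mem_segment {V : Type*} [AddCommGroup V] [Module ℝ V]
    {a x y : V} (h : x ∈ segment ℝ a y) (hxy : x ≠ y) (hax : a ≠ x) :
    ∃ s : ℝ, 0 < s ∧ a = x + s • (x - y) := by
  obtain ⟨u, v, hu, hv, huv, rfl⟩ := h
  have hu0 : u ≠ 0 := by
    rintro rfl
    obtain rfl : v = 1 := by linarith
    simp at hxy
  have hv0 : v ≠ 0 := by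
    rintro rfl
    obtain rfl : u = 1 := by linarith
    simp at hax
  obtain rfl : u = 1 - v := by linarith
  refine ⟨v / (1 - v), by positivity, ?_⟩
  match_scalars
  · field_simp
    ring
  · field_simp
    ring

namespace IsHilbertMetric

variable {V : Type*} [NormedAddCommGroup V] [NormedSpace ℝ V] {D : Set V} {d : V → V → ℝ}

theorem exists_eq_log_s9 (hd : IsHilbertMetric D d) (hDo : IsOpen D) {x y : V} (hx : x ∈ D)
    (hy : y ∈ D) (hxy : x ≠ y) :
    ∃ s r : ℝ, 0 < s ∧ 0 < r ∧ x + s • (x - y) ∈ frontier D ∧ y + r • (y - x) ∈ frontier D ∧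
      d x y = Real.log ((1 + 1 / s) * (1 + 1 / r)) := by
  obtain ⟨a, ha, b, hb, hxa, hyb, hval⟩ := hd.2 x hx y hy hxy
  have notMem_of_frontier : ∀ c ∈ frontier D, c ∉ D := fun c hc => by
    rw [hDo.frontier_eq] at hc
    exact hc.2
  obtain ⟨s, hs, rfl⟩ := exists_pos_prolongation_of_mem_segment hxa hxy
    (fun h => notMem_of_frontier a ha (h ▸ hx))
  have hyb' : y ∈ segment ℝ b x := segment_symm ℝ x b ▸ hyb
  obtain ⟨r, hr, rfl⟩ := exists_pos_prolongation_of_mem_segment hyb' hxy.symm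
    (fun h => notMem_of_frontier b hb (by rwa [h]))
  refine ⟨s, r, hs, hr, ha, hb, ?_⟩
  rw [hval]
  have hL : 0 < ‖y - x‖ := norm_pos_iff.2 (sub_ne_zero.2 hxy.symm)
  have h₁ : y - (x + s • (x - y)) = (1 + s) • (y - x) := by module
  have h₂ : x - (y + r • (y - x)) = -((1 + r) • (y - x)) := by module
  have h₃ : x - (x + s • (x - y)) = s • (y - x) := by module
  have h₄ : y - (y + r • (y - x)) = -(r • (y - x)) := by module
  rw [h₁, h₂, h₃, h₄, norm_neg, norm_neg, norm_smul, norm_smul, norm_smul, norm_smul,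
    Real.norm_of_nonneg (by positivity : 0 ≤ 1 + s),
    Real.norm_of_nonneg (by positivity : 0 ≤ 1 + r),
    Real.norm_of_nonneg hs.le, Real.norm_of_nonneg hr.le]
  congr 1
  field_simp
  ring

/-- A homothety centred in `D` with ratio in `(0, 1)` strictly contracts the Hilbert metric. -/
theorem homothety_lt (hd : IsHilbertMetric D d) (hDo : IsOpen D) (hDc : Convex ℝ D)
    {x p q : V} (hx : x ∈ D) (hp : p ∈ D) (hq : q ∈ D) (hpq : p ≠ q) {t : ℝ} (ht0 : 0 < t)
    (ht1 : t < 1) :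
    d ((1 - t) • x + t • p) ((1 - t) • x + t • q) < d p q := by
  have ht1' : 0 < 1 - t := by linarith
  have image_mem : ∀ c ∈ closure D, (1 - t) • x + t • c ∈ D := fun c hc => by
    have := hDc.combo_interior_closure_mem_interior (hDo.interior_eq.symm ▸ hx) hc ht1' ht0.le
      (by ring)
    rwa [hDo.interior_eq] at this
  have hz := image_mem p (subset_closure hp)
  have hw := image_mem q (subset_closure hq)
  set z := (1 - t) • x + t • p with hzdef
  set w := (1 - t) • x + t • q with hwdef
  have hzw : z ≠ w := fun h =>
    hpq (smul_right_injective V ht0.ne' (add_left_cancel h))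
  have lt_of_prolongation : ∀ {u v : V} {s s' : ℝ}, u ∈ D → 0 < s → 0 < s' →
      u + s • v ∈ D → u + s' • v ∈ frontier D → s < s' := fun {u v s s'} hu hs hs' h h' => by
    by_contra! hle
    rw [hDo.frontier_eq] at h'
    refine h'.2 ?_
    have := hDc.add_smul_mem hu h (t := s' / s) ⟨by positivity, (div_le_one hs).2 hle⟩
    rwa [smul_smul, div_mul_cancel₀ _ hs.ne'] at this
  obtain ⟨s, r, hs, hr, ha, hb, hval⟩ := hd.exists_eq_log_s9 hDo hp hq hpq
  obtain ⟨s', r', hs', hr', ha', hb', hval'⟩ := hd.exists_eq_log_s9 hDo hz hw hzw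
  have hss : s < s' := by
    refine lt_of_prolongation hz hs hs' ?_ ha'
    convert image_mem _ (frontier_subset_closure ha) using 1
    rw [hzdef, hwdef]
    module
  have hrr : r < r' := by
    refine lt_of_prolongation hw hr hr' ?_ hb'
    convert image_mem _ (frontier_subset_closure hb) using 1
    rw [hzdef, hwdef]
    module
  rw [hval, hval']
  apply Real.log_lt_log (by positivity)
  gcongr

theorem eq_of_eq_homothety (hd : IsHilbertMetric D d) (hDo : IsOpen D) (hDc : Convex ℝ D)
    {F : V → V} (hFmaps : ∀ y ∈ D, F y ∈ D) (hFne : ∀ x ∈ D, ∀ y ∈ D, d (F x) (F y) ≤ d x y)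
    {x z w : V} (hx : x ∈ D) (hz : z ∈ D) (hw : w ∈ D) {t : ℝ} (ht0 : 0 < t) (ht1 : t < 1)
    (hzF : z = (1 - t) • x + t • F z) (hwF : w = (1 - t) • x + t • F w) : z = w := by
  by_contra hne
  have hF : F z ≠ F w := fun h => hne (by rw [hzF, hwF, h])
  have := hd.homothety_lt hDo hDc hx (hFmaps z hz) (hFmaps w hw) hF ht0 ht1
  rw [← hzF, ← hwF] at this
  exact (this.trans_le (hFne z hz w hw)).false

end IsHilbertMetric

theorem resolvent_identity
    {V : Type*} [NormedAddCommGroup V] [NormedSpace ℝ V] [FiniteDimensional ℝ V]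
    (D : Set V) (hDo : IsOpen D) (hDc : Convex ℝ D) (hDb : Bornology.IsBounded D)
    (hDn : D.Nonempty)
    (dH : V → V → ℝ) (hdH : IsHilbertMetric D dH)
    (F : V → V) (hFmaps : ∀ y ∈ D, F y ∈ D)
    (hFne : ∀ x ∈ D, ∀ y ∈ D, dH (F x) (F y) ≤ dH x y)
    (lam mu : ℝ) (hmu : 0 < mu) (hmulam : mu < lam)
    (Rlam Rmu : V → V)
    (hRlam : ∀ x ∈ D, Rlam x ∈ D ∧
      Rlam x = (1 / (1 + lam)) • x + (lam / (1 + lam)) • F (Rlam x))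
    (hRmu : ∀ x ∈ D, Rmu x ∈ D ∧
      Rmu x = (1 / (1 + mu)) • x + (mu / (1 + mu)) • F (Rmu x)) :
    ∀ x ∈ D, Rlam x = Rmu (((lam - mu) / lam) • Rlam x + (mu / lam) • x) := by
  intro x hx
  have hlam : 0 < lam := hmu.trans hmulam
  obtain ⟨hz, hzF⟩ := hRlam x hx
  have hy : ((lam - mu) / lam) • Rlam x + (mu / lam) • x ∈ D :=
    hDc hz hx (div_nonneg (by linarith) hlam.le) (by positivity) (by field_simp; ring)
  obtain ⟨hw, hwF⟩ := hRmu _ hy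
  have ht : 1 - mu / (1 + mu) = 1 / (1 + mu) := by
    field_simp
    ring
  refine hdH.eq_of_eq_homothety hDo hDc hFmaps hFne hy hz hw (t := mu / (1 + mu)) (by positivity)
    ((div_lt_one (by positivity)).2 (by linarith)) ?_ (by rwa [ht])
  generalize Rlam x = z at hzF ⊢
  have hxz : x = (1 + lam) • z - lam • F z := by
    nth_rw 1 [hzF]
    match_scalars <;> field_simp
    ring
  rw [ht, hxz]
  match_scalars <;> field_simp <;> ring
end

section
/- Let D be a nonempty bounded convex open subset of a finite-dimensional real normed vector space with Hilbert metric d_H, let F : D → D be nonexpansive with respect to d_H and without fixed points, and let {R_λ}_{λ>0} be the family of resolvents of F. Then the attractor Ω_{{R_λ}} is contained in the boundary ∂D; that is, for every x ∈ D, every increasing sequence λ_n → ∞, and every y ∈ closure(D) with ‖R_{λ_n}(x) − y‖ → 0, one has y ∈ ∂D. -/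
open Filter Topology

/-- Data behind the value of a Hilbert metric at two distinct points, with both distances to the
boundary along the chord separated from the distance between the points. -/
theorem IsHilbertMetric.exists_chord {V : Type*} [NormedAddCommGroup V] [NormedSpace ℝ V]
    {D : Set V} {d : V → V → ℝ} (hd : IsHilbertMetric D d) (hDo : IsOpen D)
    {x y : V} (hx : x ∈ D) (hy : y ∈ D) (hxy : x ≠ y) :
    ∃ a ∈ frontier D, ∃ b ∈ frontier D, 0 < ‖x - a‖ ∧ 0 < ‖y - b‖ ∧
      d x y = Real.log ((1 + ‖x - y‖ / ‖x - a‖) * (1 + ‖x - y‖ / ‖y - b‖)) := by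
  obtain ⟨a, ha, b, hb, hxa, hyb, h⟩ := hd.2 x hx y hy hxy
  rw [hDo.frontier_eq] at ha hb
  have hpa : 0 < ‖x - a‖ := norm_sub_pos_iff.2 fun h => ha.2 (h ▸ hx)
  have hpb : 0 < ‖y - b‖ := norm_sub_pos_iff.2 fun h => hb.2 (h ▸ hy)
  refine ⟨a, hDo.frontier_eq ▸ ha, b, hDo.frontier_eq ▸ hb, hpa, hpb, ?_⟩
  have h1 := dist_add_dist_of_mem_segment hxa
  have h2 := dist_add_dist_of_mem_segment hyb
  rw [dist_comm a x, dist_comm a y] at h1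
  simp only [dist_eq_norm] at h1 h2
  rw [h, ← h1, ← h2]
  congr 1
  field_simp
  ring

/-- On a bounded domain the Hilbert metric controls the norm. -/
theorem IsHilbertMetric.exists_norm_sub_le {V : Type*} [NormedAddCommGroup V] [NormedSpace ℝ V]
    {D : Set V} {d : V → V → ℝ} (hd : IsHilbertMetric D d) (hDo : IsOpen D)
    (hDb : Bornology.IsBounded D) :
    ∃ M : ℝ, 0 < M ∧ ∀ x ∈ D, ∀ y ∈ D, ‖x - y‖ ≤ M * (Real.exp (d x y) - 1) := by
  obtain ⟨C, hC⟩ := Metric.isBounded_iff.1 hDb.closure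
  refine ⟨max C 1, by positivity, fun x hx y hy => ?_⟩
  rcases eq_or_ne x y with rfl | hxy
  · simp [hd.1 x hx]
  obtain ⟨a, ha, b, -, hpa, hpb, h⟩ := hd.exists_chord hDo hx hy hxy
  have hxa : ‖x - a‖ ≤ max C 1 := by
    rw [← dist_eq_norm]
    exact (hC (subset_closure hx) (frontier_subset_closure ha)).trans (le_max_left _ _)
  rw [h, Real.exp_log (by positivity)]
  have h1 : ‖x - y‖ / max C 1 ≤ ‖x - y‖ / ‖x - a‖ := by gcongr
  have h2 : 0 ≤ ‖x - y‖ / ‖y - b‖ := by positivity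
  have h3 : 0 ≤ ‖x - y‖ / ‖x - a‖ := by positivity
  rw [mul_comm, ← div_le_iff₀ (by positivity)]
  nlinarith

/-- Away from the boundary the norm controls the Hilbert metric. -/
theorem IsHilbertMetric.le_of_ball_subset {V : Type*} [NormedAddCommGroup V] [NormedSpace ℝ V]
    {D : Set V} {d : V → V → ℝ} (hd : IsHilbertMetric D d) (hDo : IsOpen D)
    {x y : V} {r : ℝ} (hr : 0 < r) (hx : Metric.ball x r ⊆ D) (hy : Metric.ball y r ⊆ D) :
    d x y ≤ 2 * (‖x - y‖ / r) := by
  have hxD := hx (Metric.mem_ball_self hr)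
  have hyD := hy (Metric.mem_ball_self hr)
  rcases eq_or_ne x y with rfl | hxy
  · simp [hd.1 x hxD]
  obtain ⟨a, ha, b, hb, hpa, hpb, h⟩ := hd.exists_chord hDo hxD hyD hxy
  rw [hDo.frontier_eq] at ha hb
  have hra : r ≤ ‖x - a‖ := by
    by_contra! hlt
    exact ha.2 (hx (by rwa [Metric.mem_ball', dist_eq_norm]))
  have hrb : r ≤ ‖y - b‖ := by
    by_contra! hlt
    exact hb.2 (hy (by rwa [Metric.mem_ball', dist_eq_norm]))
  rw [h, Real.log_mul (by positivity) (by positivity)]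
  have h1 := Real.log_le_sub_one_of_pos (x := 1 + ‖x - y‖ / ‖x - a‖) (by positivity)
  have h2 := Real.log_le_sub_one_of_pos (x := 1 + ‖x - y‖ / ‖y - b‖) (by positivity)
  have h3 : ‖x - y‖ / ‖x - a‖ ≤ ‖x - y‖ / r := by gcongr
  have h4 : ‖x - y‖ / ‖y - b‖ ≤ ‖x - y‖ / r := by gcongr
  linarith

/-- A self-map that is nonexpansive for the Hilbert metric is sequentially continuous in norm. -/
theorem IsHilbertMetric.tendsto_of_nonexpansive {V : Type*} [NormedAddCommGroup V]
    [NormedSpace ℝ V] {D : Set V} {d : V → V → ℝ} (hd : IsHilbertMetric D d) (hDo : IsOpen D)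
    (hDb : Bornology.IsBounded D) {F : V → V} (hF : ∀ y ∈ D, F y ∈ D)
    (hFne : ∀ x ∈ D, ∀ y ∈ D, d (F x) (F y) ≤ d x y)
    {z : ℕ → V} {y : V} (hy : y ∈ D) (hzy : Tendsto z atTop (𝓝 y)) :
    Tendsto (fun n => F (z n)) atTop (𝓝 (F y)) := by
  obtain ⟨M, hM, hlow⟩ := hd.exists_norm_sub_le hDo hDb
  obtain ⟨r, hr, hball⟩ := Metric.isOpen_iff.1 hDo y hy
  have hlim : Tendsto (fun n => M * (Real.exp (2 * (‖z n - y‖ / (r / 2))) - 1)) atTop (𝓝 0) := by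
    have hc : Continuous fun t : ℝ => M * (Real.exp (2 * (t / (r / 2))) - 1) := by fun_prop
    simpa [Function.comp_def] using (hc.tendsto 0).comp (tendsto_iff_norm_sub_tendsto_zero.1 hzy)
  refine tendsto_iff_norm_sub_tendsto_zero.2 (squeeze_zero' (by simp) ?_ hlim)
  filter_upwards [hzy.eventually (Metric.ball_mem_nhds y (half_pos hr))] with n hn
  have hzb : Metric.ball (z n) (r / 2) ⊆ D :=
    (Metric.ball_subset_ball' (by linarith)).trans hball
  have hzD : z n ∈ D := hzb (Metric.mem_ball_self (half_pos hr))
  refine (hlow _ (hF _ hzD) _ (hF _ hy)).trans ?_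
  gcongr
  exact (hFne _ hzD _ hy).trans (hd.le_of_ball_subset hDo (half_pos hr) hzb
    ((Metric.ball_subset_ball (by linarith)).trans hball))

theorem attractor_of_resolvents_subset_boundary
    {V : Type*} [NormedAddCommGroup V] [NormedSpace ℝ V] [FiniteDimensional ℝ V]
    (D : Set V) (hDo : IsOpen D) (hDc : Convex ℝ D) (hDb : Bornology.IsBounded D)
    (hDn : D.Nonempty)
    (dH : V → V → ℝ) (hdH : IsHilbertMetric D dH)
    (F : V → V) (hFmaps : ∀ y ∈ D, F y ∈ D)
    (hFne : ∀ x ∈ D, ∀ y ∈ D, dH (F x) (F y) ≤ dH x y)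
    (hFfix : ∀ x ∈ D, F x ≠ x)
    (R : ℝ → V → V)
    (hR : ∀ lam : ℝ, 0 < lam → ∀ x ∈ D, R lam x ∈ D ∧
      R lam x = (1 / (1 + lam)) • x + (lam / (1 + lam)) • F (R lam x)) :
    ∀ x ∈ D, ∀ l : ℕ → ℝ, (∀ n, 0 < l n) → StrictMono l →
      Filter.Tendsto l Filter.atTop Filter.atTop →
      ∀ y ∈ closure D, Filter.Tendsto (fun n => ‖R (l n) x - y‖) Filter.atTop (nhds 0) →
        y ∈ closure D \ D := by
  intro x hx l hl _ hlt y hy hzy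
  refine ⟨hy, fun hyD => hFfix y hyD ?_⟩
  have hz : Tendsto (fun n => R (l n) x) atTop (𝓝 y) := tendsto_iff_norm_sub_tendsto_zero.2 hzy
  have hFz := hdH.tendsto_of_nonexpansive hDo hDb hFmaps hFne hyD hz
  have hFy : Tendsto (fun n => F (R (l n) x)) atTop (𝓝 y) := by
    have hlim : Tendsto (fun n => R (l n) x + (l n)⁻¹ • (R (l n) x - x)) atTop (𝓝 y) := by
      simpa using hz.add ((tendsto_inv_atTop_zero.comp hlt).smul (hz.sub_const x))
    refine hlim.congr fun n => ?_
    have hpos := hl n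
    have h := (hR (l n) hpos x hx).2
    have h' : (1 + l n) • R (l n) x = x + l n • F (R (l n) x) := by
      conv_lhs => rw [h]
      rw [smul_add, smul_smul, smul_smul, mul_one_div_cancel (by positivity), one_smul,
        mul_div_cancel₀ _ (by positivity)]
    have h'' : R (l n) x - x = l n • (F (R (l n) x) - R (l n) x) := by
      rw [add_smul, one_smul] at h'
      rw [smul_sub, sub_eq_sub_iff_add_eq_add, h', add_comm]
    rw [h'', inv_smul_smul₀ hpos.ne', add_sub_cancel]
  exact tendsto_nhds_unique hFz hFy
end

section
/- Let D be a nonempty bounded convex open subset of a finite-dimensional real normed vector space with Hilbert metric d_H. If {x_n} and {y_n} are sequences in D converging in norm to points x ∈ ∂D and y ∈ ∂D respectively, and the segment [x,y] is not contained in ∂D, then for every z ∈ D, lim_{n→∞} ( d_H(x_n, y_n) − max{d_H(x_n, z), d_H(y_n, z)} ) = ∞. -/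
open Filter Topology Metric in
/-- If a convex open set contains the ball of radius `r` about `w`, then the distance to the
complement grows at least linearly along the segment from a point `a` of the closure to `w`. -/
theorem Convex.norm_sub_mul_le_norm_sub_mul_infDist_compl
    {V : Type*} [NormedAddCommGroup V] [NormedSpace ℝ V] {D : Set V}
    (hDo : IsOpen D) (hDc : Convex ℝ D) (hne : Dᶜ.Nonempty) {a p w : V} {r : ℝ}
    (ha : a ∈ closure D) (hw : ball w r ⊆ D) (hp : p ∈ segment ℝ a w) :
    ‖p - a‖ * r ≤ ‖w - a‖ * infDist p Dᶜ := by
  obtain ⟨s, t, hs, ht, hst, rfl⟩ := hp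
  have hsub : s • a + t • w - a = t • (w - a) := by
    obtain rfl : s = 1 - t := by linarith
    module
  have key : t * r ≤ infDist (s • a + t • w) Dᶜ := by
    rw [le_infDist hne]
    intro q hq
    by_contra! hlt
    have ht0 : 0 < t := by
      rcases ht.eq_or_lt with h | h
      · rw [← h, zero_mul] at hlt
        exact absurd hlt dist_nonneg.not_gt
      · exact h
    have hmem : w + t⁻¹ • (q - (s • a + t • w)) ∈ interior D := by
      rw [hDo.interior_eq]
      apply hw
      rw [mem_ball, dist_eq_norm, add_sub_cancel_left, norm_smul, norm_inv,
        Real.norm_of_nonneg ht, inv_mul_lt_iff₀ ht0, ← dist_eq_norm, dist_comm]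
      exact hlt
    have hq' := interior_subset (hDc.combo_closure_interior_mem_interior ha hmem hs ht0 hst)
    rw [smul_add, smul_inv_smul₀ ht0.ne'] at hq'
    apply hq
    convert hq' using 1
    abel
  rw [hsub, norm_smul, Real.norm_of_nonneg ht]
  nlinarith [norm_nonneg (w - a)]

open Metric in
theorem IsOpen.infDist_compl_pos {V : Type*} [PseudoMetricSpace V] {D : Set V}
    (hDo : IsOpen D) (hne : Dᶜ.Nonempty) {p : V} (hp : p ∈ D) : 0 < infDist p Dᶜ :=
  (hDo.isClosed_compl.notMem_iff_infDist_pos hne).1 (by simpa using hp)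

open Metric in
theorem IsHilbertMetric.le_log_div_infDist
    {V : Type*} [NormedAddCommGroup V] [NormedSpace ℝ V] {D : Set V} {d : V → V → ℝ}
    (hd : IsHilbertMetric D d) (hDo : IsOpen D) (hne : Dᶜ.Nonempty) {M : ℝ}
    (hM : ∀ p ∈ closure D, ∀ q ∈ closure D, ‖p - q‖ ≤ M) {p z : V}
    (hp : p ∈ D) (hz : z ∈ D) (hpz : p ≠ z) :
    d p z ≤ Real.log (M ^ 2 / (infDist p Dᶜ * infDist z Dᶜ)) := by
  obtain ⟨a, ha, b, hb, -, -, h⟩ := hd.2 p hp z hz hpz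
  rw [hDo.frontier_eq] at ha hb
  have hp0 := hDo.infDist_compl_pos hne hp
  have hz0 := hDo.infDist_compl_pos hne hz
  have hpa : infDist p Dᶜ ≤ ‖p - a‖ := dist_eq_norm p a ▸ infDist_le_dist_of_mem ha.2
  have hzb : infDist z Dᶜ ≤ ‖z - b‖ := dist_eq_norm z b ▸ infDist_le_dist_of_mem hb.2
  have hza := hM z (subset_closure hz) a ha.1
  have hpb := hM p (subset_closure hp) b hb.1
  have hza0 : 0 < ‖z - a‖ := norm_pos_iff.2 (sub_ne_zero.2 fun e => ha.2 (e ▸ hz))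
  have hpb0 : 0 < ‖p - b‖ := norm_pos_iff.2 (sub_ne_zero.2 fun e => hb.2 (e ▸ hp))
  have hpa0 := hp0.trans_le hpa
  have hzb0 := hz0.trans_le hzb
  have hM0 := hza0.trans_le hza
  rw [h, sq]
  exact Real.log_le_log (by positivity) (by gcongr)

open Metric in
theorem IsHilbertMetric.log_div_infDist_le
    {V : Type*} [NormedAddCommGroup V] [NormedSpace ℝ V] {D : Set V} {d : V → V → ℝ}
    (hd : IsHilbertMetric D d) (hDo : IsOpen D) (hDc : Convex ℝ D) (hne : Dᶜ.Nonempty) {M : ℝ}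
    (hM : ∀ p ∈ closure D, ∀ q ∈ closure D, ‖p - q‖ ≤ M) {p q w : V} {r c : ℝ}
    (hr : 0 < r) (hc : 0 < c) (hp : p ∈ D) (hq : q ∈ D) (hpq : c ≤ ‖p - q‖)
    (hw : w ∈ segment ℝ p q) (hball : ball w r ⊆ D) :
    Real.log ((c * r / M) ^ 2 / (infDist p Dᶜ * infDist q Dᶜ)) ≤ d p q := by
  have hne' : p ≠ q := fun e => by
    rw [e, sub_self, norm_zero] at hpq
    exact hc.not_ge hpq
  obtain ⟨a, ha, b, hb, hpa, hqb, h⟩ := hd.2 p hp q hq hne'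
  rw [hDo.frontier_eq] at ha hb
  have hM0 : 0 < M := hc.trans_le (hpq.trans (hM p (subset_closure hp) q (subset_closure hq)))
  have hp0 := hDo.infDist_compl_pos hne hp
  have hq0 := hDo.infDist_compl_pos hne hq
  have hwc : w ∈ closure D := subset_closure (hball (mem_ball_self hr))
  rw [mem_segment_iff_wbtw] at hpa hqb hw
  have hpaw := hDc.norm_sub_mul_le_norm_sub_mul_infDist_compl hDo hne ha.1 hball
    (mem_segment_iff_wbtw.2 (hpa.trans_right_left hw))
  have hqbw := hDc.norm_sub_mul_le_norm_sub_mul_infDist_compl hDo hne hb.1 hball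
    (mem_segment_iff_wbtw.2 (hqb.symm.trans_right_left hw.symm))
  have hpa1 : ‖p - a‖ ≤ M * infDist p Dᶜ / r := by
    rw [le_div_iff₀ hr]
    exact hpaw.trans (by gcongr; exact hM w hwc a ha.1)
  have hqb1 : ‖q - b‖ ≤ M * infDist q Dᶜ / r := by
    rw [le_div_iff₀ hr]
    exact hqbw.trans (by gcongr; exact hM w hwc b hb.1)
  have hpa0 : 0 < ‖p - a‖ := norm_pos_iff.2 (sub_ne_zero.2 fun e => ha.2 (e ▸ hp))
  have hqb0 : 0 < ‖q - b‖ := norm_pos_iff.2 (sub_ne_zero.2 fun e => hb.2 (e ▸ hq))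
  have hqa : c ≤ ‖q - a‖ := by
    have := hpa.dist_add_dist
    rw [dist_eq_norm, dist_comm a q, dist_eq_norm, dist_eq_norm] at this
    linarith [norm_nonneg (a - p)]
  have hpb : c ≤ ‖p - b‖ := by
    have := hqb.dist_add_dist
    rw [dist_eq_norm, dist_eq_norm, dist_eq_norm] at this
    linarith [norm_nonneg (q - b)]
  rw [h]
  refine Real.log_le_log (by positivity) ?_
  calc (c * r / M) ^ 2 / (infDist p Dᶜ * infDist q Dᶜ)
      = c * c / (M * infDist p Dᶜ / r * (M * infDist q Dᶜ / r)) := by field_simp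
    _ ≤ _ := by gcongr

open Filter Topology Metric in
theorem karlsson_noskov_lemma
    {V : Type*} [NormedAddCommGroup V] [NormedSpace ℝ V] [FiniteDimensional ℝ V]
    (D : Set V) (hDo : IsOpen D) (hDc : Convex ℝ D) (hDb : Bornology.IsBounded D)
    (hDn : D.Nonempty)
    (dH : V → V → ℝ) (hdH : IsHilbertMetric D dH)
    (xn yn : ℕ → V) (hxn : ∀ n, xn n ∈ D) (hyn : ∀ n, yn n ∈ D)
    (x y : V) (hx : x ∈ closure D \ D) (hy : y ∈ closure D \ D)
    (hxlim : Filter.Tendsto xn Filter.atTop (nhds x))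
    (hylim : Filter.Tendsto yn Filter.atTop (nhds y))
    (hseg : ¬ segment ℝ x y ⊆ closure D \ D) :
    ∀ z ∈ D, Filter.Tendsto
      (fun n => dH (xn n) (yn n) - max (dH (xn n) z) (dH (yn n) z))
      Filter.atTop Filter.atTop := by
  intro z hz
  have hne : Dᶜ.Nonempty := ⟨x, hx.2⟩
  have hxy : x ≠ y := by
    rintro rfl
    exact hseg (by simpa using hx)
  obtain ⟨w, ⟨s, t, hs, ht, hst, hw⟩, hwD⟩ : ∃ w ∈ segment ℝ x y, w ∈ D := by
    obtain ⟨w, hw, hwn⟩ := Set.not_subset.1 hseg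
    exact ⟨w, hw, by_contra fun h => hwn ⟨hDc.closure.segment_subset hx.1 hy.1 hw, h⟩⟩
  obtain ⟨ρ, hρ, hball⟩ := isOpen_iff.1 hDo w hwD
  obtain ⟨M, hM⟩ := isBounded_iff.1 hDb.closure
  replace hM : ∀ p ∈ closure D, ∀ q ∈ closure D, ‖p - q‖ ≤ M := fun p hp q hq =>
    dist_eq_norm p q ▸ hM hp hq
  have hxy0 : 0 < ‖x - y‖ := norm_pos_iff.2 (sub_ne_zero.2 hxy)
  have hM0 : 0 < M := hxy0.trans_le (hM x hx.1 y hy.1)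
  have hz0 := hDo.infDist_compl_pos hne hz
  have hwlim : Tendsto (fun n => s • xn n + t • yn n) atTop (𝓝 w) :=
    hw ▸ (hxlim.const_smul s).add (hylim.const_smul t)
  have hlog : ∀ {u : ℕ → V} {v : V}, (∀ n, u n ∈ D) → v ∉ D → Tendsto u atTop (𝓝 v) →
      Tendsto (fun n => Real.log (infDist (u n) Dᶜ)) atTop atBot := by
    intro u v hu hv hlim
    refine Real.tendsto_log_nhdsGT_zero.comp (tendsto_nhdsWithin_iff.2 ⟨?_, ?_⟩)
    · have := ((continuous_infDist_pt Dᶜ).tendsto v).comp hlim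
      rwa [infDist_zero_of_mem (show v ∈ Dᶜ from hv)] at this
    · exact Eventually.of_forall fun n => hDo.infDist_compl_pos hne (hu n)
  set K : ℝ := Real.log ((‖x - y‖ / 2 * (ρ / 2) / M) ^ 2) - Real.log (M ^ 2)
    + Real.log (infDist z Dᶜ)
  refine tendsto_atTop.2 fun B => ?_
  filter_upwards [(hlog hxn hx.2 hxlim).eventually_le_atBot (K - B),
    (hlog hyn hy.2 hylim).eventually_le_atBot (K - B),
    hwlim.eventually (ball_mem_nhds w (half_pos hρ)),
    (hxlim.sub hylim).norm.eventually (lt_mem_nhds (half_lt_self hxy0)),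
    hxlim.eventually_ne (show x ≠ z from fun e => hx.2 (e ▸ hz)),
    hylim.eventually_ne (show y ≠ z from fun e => hy.2 (e ▸ hz))] with n hBx hBy hwn hc hxz hyz
  have hsub : ball (s • xn n + t • yn n) (ρ / 2) ⊆ D :=
    (ball_subset_ball' (by linarith [mem_ball.1 hwn])).trans hball
  have hlow := hdH.log_div_infDist_le hDo hDc hne hM (half_pos hρ) (half_pos hxy0) (hxn n) (hyn n)
    hc.le ⟨s, t, hs, ht, hst, rfl⟩ hsub
  have hupx := hdH.le_log_div_infDist hDo hne hM (hxn n) hz hxz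
  have hupy := hdH.le_log_div_infDist hDo hne hM (hyn n) hz hyz
  have hx0 := hDo.infDist_compl_pos hne (hxn n)
  have hy0 := hDo.infDist_compl_pos hne (hyn n)
  rw [Real.log_div (by positivity) (by positivity), Real.log_mul hx0.ne' hy0.ne'] at hlow
  rw [Real.log_div (by positivity) (by positivity), Real.log_mul hx0.ne' hz0.ne'] at hupx
  rw [Real.log_div (by positivity) (by positivity), Real.log_mul hy0.ne' hz0.ne'] at hupy
  rw [le_sub_comm, max_le_iff]
  constructor <;> linarith
end

section
/- Let D be a nonempty bounded convex open subset of a finite-dimensional real normed vector space, and suppose the Hilbert metric d_H on D satisfies condition (D). Let F : D → D be nonexpansive with respect to d_H and without fixed points, and let {R_λ}_{λ>0} be the family of resolvents of F. Then the convex hull of the attractor Ω_{{R_λ}} is contained in the boundary ∂D: any convex combination of finitely many points of Ω_{{R_λ}} lies in ∂D. -/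
open Filter Topology

/-- `β` bounds the exponential of the Funk distance from `x` to `y` in `D`: the point of the ray
from `x` through `y` at parameter `β / (β - 1)` still belongs to the closure of `D`. -/
def IsFunkBound {V : Type*} [NormedAddCommGroup V] [NormedSpace ℝ V]
    (D : Set V) (x y : V) (β : ℝ) : Prop :=
  1 ≤ β ∧ ∃ c ∈ closure D, β • y - x = (β - 1) • c

/-- The exponential of the Funk distance from `x` to `y` in `D`. -/
noncomputable def expFunk {V : Type*} [NormedAddCommGroup V] [NormedSpace ℝ V]
    (D : Set V) (x y : V) : ℝ :=
  sInf {β | IsFunkBound D x y β}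

section FunkBound

variable {V : Type*} [NormedAddCommGroup V] [NormedSpace ℝ V] {D : Set V}

lemma IsFunkBound.mono (hDc : Convex ℝ D) {x y : V} (hy : y ∈ D) {β γ : ℝ}
    (h : IsFunkBound D x y β) (hβγ : β ≤ γ) : IsFunkBound D x y γ := by
  obtain ⟨h1, c, hc, hxy⟩ := h
  refine ⟨h1.trans hβγ, ?_⟩
  rcases eq_or_lt_of_le (h1.trans hβγ) with h | h
  · obtain rfl : β = γ := by linarith
    exact ⟨c, hc, hxy⟩
  · have hγ : 0 < γ - 1 := by linarith
    refine ⟨((γ - β) / (γ - 1)) • y + ((β - 1) / (γ - 1)) • c,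
      hDc.closure (subset_closure hy) hc (div_nonneg (by linarith) hγ.le)
        (div_nonneg (by linarith) hγ.le) (by field_simp; ring), ?_⟩
    rw [smul_add, smul_smul, smul_smul, mul_div_cancel₀ _ hγ.ne', mul_div_cancel₀ _ hγ.ne', ← hxy]
    module

lemma IsFunkBound.mul (hDc : Convex ℝ D) {x y z : V} {β γ : ℝ}
    (h : IsFunkBound D x y β) (h' : IsFunkBound D y z γ) : IsFunkBound D x z (β * γ) := by
  obtain ⟨h1, c, hc, hxy⟩ := h
  obtain ⟨h1', c', hc', hyz⟩ := h'
  have hle : 1 ≤ β * γ := by nlinarith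
  refine ⟨hle, ?_⟩
  have key : (β * γ) • z - x = (β * (γ - 1)) • c' + (β - 1) • c := by
    rw [← hxy, mul_smul β (γ - 1) c', ← hyz]; module
  rcases eq_or_lt_of_le hle with h | h
  · have hβ : β = 1 := by nlinarith
    have hγ : γ = 1 := by nlinarith
    refine ⟨c, hc, ?_⟩
    rw [key, hβ, hγ]; simp
  · have h0 : 0 < β * γ - 1 := by linarith
    refine ⟨(β * (γ - 1) / (β * γ - 1)) • c' + ((β - 1) / (β * γ - 1)) • c,
      hDc.closure hc' hc (div_nonneg (by nlinarith) h0.le)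
        (div_nonneg (by linarith) h0.le) (by field_simp; ring), ?_⟩
    rw [key, smul_add, smul_smul, smul_smul, mul_div_cancel₀ _ h0.ne', mul_div_cancel₀ _ h0.ne']

/-- Along a segment, an upper bound for the Funk distance between the endpoints splits as a sum
of upper bounds. -/
lemma IsFunkBound.split {x y : V} {β a : ℝ} (ha0 : 0 ≤ a) (ha1 : a ≤ 1)
    (h : IsFunkBound D x y β) :
    ∃ β₁ β₂, IsFunkBound D x ((1 - a) • x + a • y) β₁ ∧
      IsFunkBound D ((1 - a) • x + a • y) y β₂ ∧ β₁ * β₂ = β := by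
  obtain ⟨h1, c, hc, hxy⟩ := h
  have hγ : 1 ≤ 1 + (1 - a) * (β - 1) := by nlinarith
  have hγ0 : 0 < 1 + (1 - a) * (β - 1) := by linarith
  have hcy : (β - 1) • c = β • y - x := hxy.symm
  refine ⟨β / (1 + (1 - a) * (β - 1)), 1 + (1 - a) * (β - 1),
    ⟨?_, c, hc, ?_⟩, ⟨hγ, c, hc, ?_⟩, div_mul_cancel₀ _ hγ0.ne'⟩
  · rw [one_le_div hγ0]; nlinarith
  · have e : β / (1 + (1 - a) * (β - 1)) - 1 =
        (a / (1 + (1 - a) * (β - 1))) * (β - 1) := by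
      field_simp; ring
    rw [e, mul_smul, hcy]
    match_scalars <;> field_simp
    ring
  · rw [add_sub_cancel_left, mul_smul, hcy]
    module

lemma isLeast_isFunkBound_ratio (hDo : IsOpen D) (hDc : Convex ℝ D) {x y b : V} (hx : x ∈ D)
    (hy : y ∈ D) (hxy : x ≠ y) (hb : b ∈ frontier D) (hseg : y ∈ segment ℝ x b) :
    IsLeast {β | IsFunkBound D x y β} (‖x - b‖ / ‖y - b‖) := by
  have hbD : b ∉ D := by
    rw [hDo.frontier_eq] at hb; exact hb.2
  obtain ⟨s, t, hs, ht, hst, rfl⟩ := hseg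
  have hs0 : 0 < s := by
    rcases hs.eq_or_lt with h | h
    · subst h
      obtain rfl : t = 1 := by linarith
      simp at hy
      exact absurd hy hbD
    · exact h
  have ht0 : 0 < t := by
    rcases ht.eq_or_lt with h | h
    · subst h
      obtain rfl : s = 1 := by linarith
      simp at hxy
    · exact h
  have hxb : 0 < ‖x - b‖ := by
    rw [norm_pos_iff, sub_ne_zero]
    rintro rfl
    exact hbD hx
  have e : s • x + t • b - b = s • (x - b) := by
    obtain rfl : t = 1 - s := by linarith
    module
  have hratio : ‖x - b‖ / ‖s • x + t • b - b‖ = 1 / s := by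
    rw [e, norm_smul, Real.norm_of_nonneg hs0.le]
    field_simp
  rw [hratio]
  have hs1 : 1 < 1 / s := by rw [lt_div_iff₀ hs0]; linarith
  have hB : (1 / s) • (s • x + t • b) - x = (1 / s - 1) • b := by
    obtain rfl : t = 1 - s := by linarith
    match_scalars <;> field_simp
    ring
  refine ⟨⟨hs1.le, b, frontier_subset_closure hb, hB⟩, ?_⟩
  rintro β ⟨hβ, c, hc, hβc⟩
  by_contra! hlt
  clear hratio
  generalize 1 / s = T at *
  set y := s • x + t • b with hydef
  have h0 : 0 < T - 1 := by linarith
  have hbeq : b = ((T - β) / (T - 1)) • y + ((β - 1) / (T - 1)) • c := by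
    have h2 : (T - 1) • b = (T - β) • y + (β - 1) • c := by
      rw [← hB, ← hβc]; module
    rw [div_eq_inv_mul, div_eq_inv_mul, mul_smul, mul_smul, ← smul_add, ← h2,
      inv_smul_smul₀ h0.ne']
  apply hbD
  rw [hbeq]
  have := hDc.combo_interior_closure_mem_interior (x := y) (y := c)
    (by rwa [hDo.interior_eq]) hc (a := (T - β) / (T - 1))
    (b := (β - 1) / (T - 1)) (div_pos (by linarith) h0)
    (div_nonneg (by linarith) h0.le) (by field_simp; ring)
  rwa [hDo.interior_eq] at this

lemma isLeast_isFunkBound_self {x : V} (hx : x ∈ D) :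
    IsLeast {β | IsFunkBound D x x β} 1 :=
  ⟨⟨le_rfl, x, subset_closure hx, by simp⟩, fun _ h => h.1⟩

/-- Points of the closure at finite Funk distance from a point of an open convex set belong to
that set. -/
lemma mem_of_isFunkBound (hDo : IsOpen D) (hDc : Convex ℝ D) {p y : V} (hp : p ∈ D) {β : ℝ}
    (h : IsFunkBound D p y β) : y ∈ D := by
  obtain ⟨h1, c, hc, hpy⟩ := h
  have h0 : 0 < β := by linarith
  have hy : y = β⁻¹ • p + (1 - β⁻¹) • c := by
    have : β • y = p + (β - 1) • c := by rw [← hpy]; abel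
    rw [← inv_smul_smul₀ h0.ne' y, this, smul_add, smul_smul]
    congr 2
    field_simp
  rw [hy]
  have := hDc.combo_interior_closure_mem_interior (x := p) (y := c)
    (by rwa [hDo.interior_eq]) hc (a := β⁻¹) (b := 1 - β⁻¹) (by positivity)
    (by linarith [inv_le_one_of_one_le₀ h1]) (by ring)
  rwa [hDo.interior_eq] at this

lemma eventually_isFunkBound (hDo : IsOpen D) {x : V} (hx : x ∈ D) {β : ℝ} (hβ : 1 < β) :
    ∀ᶠ y in 𝓝 x, IsFunkBound D x y β ∧ IsFunkBound D y x β := by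
  have h0 : β - 1 ≠ 0 := by linarith
  have h1 : Tendsto (fun y : V => (β - 1)⁻¹ • (β • y - x)) (𝓝 x) (𝓝 x) := by
    have : ContinuousAt (fun y : V => (β - 1)⁻¹ • (β • y - x)) x := by fun_prop
    have e : (β - 1)⁻¹ • (β • x - x) = x := by
      rw [show β • x - x = (β - 1) • x by module, inv_smul_smul₀ h0]
    simpa [ContinuousAt, e] using this
  have h2 : Tendsto (fun y : V => (β - 1)⁻¹ • (β • x - y)) (𝓝 x) (𝓝 x) := by
    have : ContinuousAt (fun y : V => (β - 1)⁻¹ • (β • x - y)) x := by fun_prop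
    have e : (β - 1)⁻¹ • (β • x - x) = x := by
      rw [show β • x - x = (β - 1) • x by module, inv_smul_smul₀ h0]
    simpa [ContinuousAt, e] using this
  filter_upwards [h1 (hDo.mem_nhds hx), h2 (hDo.mem_nhds hx)] with y hy1 hy2
  exact ⟨⟨hβ.le, _, subset_closure hy1, (smul_inv_smul₀ h0 _).symm⟩,
    ⟨hβ.le, _, subset_closure hy2, (smul_inv_smul₀ h0 _).symm⟩⟩

end FunkBound

namespace IsHilbertMetric

variable {V : Type*} [NormedAddCommGroup V] [NormedSpace ℝ V] {D : Set V} {d : V → V → ℝ}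

lemma isLeast_expFunk (hDo : IsOpen D) (hDc : Convex ℝ D) (hd : IsHilbertMetric D d)
    {x y : V} (hx : x ∈ D) (hy : y ∈ D) :
    IsLeast {β | IsFunkBound D x y β} (expFunk D x y) := by
  rcases eq_or_ne x y with rfl | hxy
  · have h := isLeast_isFunkBound_self hx
    rw [expFunk, h.csInf_eq]; exact h
  · obtain ⟨a, -, b, hb, -, hyb, -⟩ := hd.2 x hx y hy hxy
    have h := isLeast_isFunkBound_ratio hDo hDc hx hy hxy hb hyb
    rw [expFunk, h.csInf_eq]; exact h

lemma eq_log_expFunk (hDo : IsOpen D) (hDc : Convex ℝ D) (hd : IsHilbertMetric D d)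
    {x y : V} (hx : x ∈ D) (hy : y ∈ D) :
    d x y = Real.log (expFunk D x y * expFunk D y x) := by
  rcases eq_or_ne x y with rfl | hxy
  · rw [hd.1 x hx, expFunk, (isLeast_isFunkBound_self hx).csInf_eq]; simp
  · obtain ⟨a, ha, b, hb, hxa, hyb, h⟩ := hd.2 x hx y hy hxy
    rw [segment_symm] at hxa
    rw [h, expFunk, expFunk, (isLeast_isFunkBound_ratio hDo hDc hx hy hxy hb hyb).csInf_eq,
      (isLeast_isFunkBound_ratio hDo hDc hy hx hxy.symm ha hxa).csInf_eq, div_mul_div_comm,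
      mul_comm ‖x - b‖, mul_comm ‖y - b‖]

lemma one_le_expFunk (hDo : IsOpen D) (hDc : Convex ℝ D) (hd : IsHilbertMetric D d)
    {x y : V} (hx : x ∈ D) (hy : y ∈ D) : 1 ≤ expFunk D x y :=
  (isLeast_expFunk hDo hDc hd hx hy).1.1

lemma le_log_mul (hDo : IsOpen D) (hDc : Convex ℝ D) (hd : IsHilbertMetric D d)
    {x y : V} (hx : x ∈ D) (hy : y ∈ D) {β γ : ℝ} (hβ : IsFunkBound D x y β)
    (hγ : IsFunkBound D y x γ) : d x y ≤ Real.log (β * γ) := by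
  have h1 := one_le_expFunk hDo hDc hd hx hy
  have h2 := one_le_expFunk hDo hDc hd hy hx
  rw [eq_log_expFunk hDo hDc hd hx hy]
  apply Real.log_le_log (by positivity)
  exact mul_le_mul ((isLeast_expFunk hDo hDc hd hx hy).2 hβ)
    ((isLeast_expFunk hDo hDc hd hy hx).2 hγ) (by linarith) (by linarith [hβ.1])

lemma symm (hDo : IsOpen D) (hDc : Convex ℝ D) (hd : IsHilbertMetric D d)
    {x y : V} (hx : x ∈ D) (hy : y ∈ D) : d x y = d y x := by
  rw [eq_log_expFunk hDo hDc hd hx hy, eq_log_expFunk hDo hDc hd hy hx, mul_comm]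

lemma nonneg (hDo : IsOpen D) (hDc : Convex ℝ D) (hd : IsHilbertMetric D d)
    {x y : V} (hx : x ∈ D) (hy : y ∈ D) : 0 ≤ d x y := by
  rw [eq_log_expFunk hDo hDc hd hx hy]
  exact Real.log_nonneg (one_le_mul_of_one_le_of_one_le (one_le_expFunk hDo hDc hd hx hy)
    (one_le_expFunk hDo hDc hd hy hx))

lemma pos (hDo : IsOpen D) (hDc : Convex ℝ D) (hd : IsHilbertMetric D d)
    {x y : V} (hx : x ∈ D) (hy : y ∈ D) (hxy : x ≠ y) : 0 < d x y := by
  rw [eq_log_expFunk hDo hDc hd hx hy]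
  have h1 := one_le_expFunk hDo hDc hd hx hy
  have h2 := one_le_expFunk hDo hDc hd hy hx
  obtain ⟨-, c, -, hc⟩ := (isLeast_expFunk hDo hDc hd hx hy).1
  have h3 : 1 < expFunk D x y := by
    refine lt_of_le_of_ne h1 fun h => hxy ?_
    rw [← h] at hc
    simpa [sub_eq_zero, eq_comm] using hc
  exact Real.log_pos (by nlinarith)

lemma triangle (hDo : IsOpen D) (hDc : Convex ℝ D) (hd : IsHilbertMetric D d)
    {x y z : V} (hx : x ∈ D) (hy : y ∈ D) (hz : z ∈ D) : d x z ≤ d x y + d y z := by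
  have hxy := isLeast_expFunk hDo hDc hd hx hy
  have hyx := isLeast_expFunk hDo hDc hd hy hx
  have hyz := isLeast_expFunk hDo hDc hd hy hz
  have hzy := isLeast_expFunk hDo hDc hd hz hy
  have p1 := hxy.1.1
  have p2 := hyx.1.1
  have p3 := hyz.1.1
  have p4 := hzy.1.1
  refine (le_log_mul hDo hDc hd hx hz (hxy.1.mul hDc hyz.1) (hzy.1.mul hDc hyx.1)).trans ?_
  rw [eq_log_expFunk hDo hDc hd hx hy, eq_log_expFunk hDo hDc hd hy hz,
    ← Real.log_mul (by positivity) (by positivity)]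
  apply le_of_eq
  congr 1
  ring

/-- Straight segments are geodesics of the Hilbert metric. -/
lemma add_le_of_combo (hDo : IsOpen D) (hDc : Convex ℝ D) (hd : IsHilbertMetric D d)
    {x y : V} (hx : x ∈ D) (hy : y ∈ D) {a : ℝ} (ha0 : 0 ≤ a) (ha1 : a ≤ 1) :
    d x ((1 - a) • x + a • y) + d ((1 - a) • x + a • y) y ≤ d x y := by
  have hw : (1 - a) • x + a • y ∈ D := hDc hx hy (by linarith) ha0 (by ring)
  obtain ⟨β₁, β₂, h1, h2, h12⟩ := (isLeast_expFunk hDo hDc hd hx hy).1.split ha0 ha1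
  obtain ⟨γ₁, γ₂, k1, k2, k12⟩ := (isLeast_expFunk hDo hDc hd hy hx).1.split
    (a := 1 - a) (by linarith) (by linarith)
  rw [show (1 - (1 - a)) • y + (1 - a) • x = (1 - a) • x + a • y by module] at k1 k2
  have p1 := h1.1
  have p2 := h2.1
  have p3 := k1.1
  have p4 := k2.1
  refine (add_le_add (le_log_mul hDo hDc hd hx hw h1 k2) (le_log_mul hDo hDc hd hw hy h2 k1)).trans
    ?_
  rw [eq_log_expFunk hDo hDc hd hx hy, ← Real.log_mul (by positivity) (by positivity),
    ← h12, ← k12]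
  apply le_of_eq
  congr 1
  ring

lemma eventually_lt (hDo : IsOpen D) (hDc : Convex ℝ D) (hd : IsHilbertMetric D d)
    {x : V} (hx : x ∈ D) {ε : ℝ} (hε : 0 < ε) : ∀ᶠ y in 𝓝 x, y ∈ D ∧ d x y < ε := by
  have hβ : 1 < Real.exp (ε / 3) := Real.one_lt_exp_iff.2 (by linarith)
  filter_upwards [hDo.mem_nhds hx, eventually_isFunkBound hDo hx hβ] with y hy h
  refine ⟨hy, (le_log_mul hDo hDc hd hx hy h.1 h.2).trans_lt ?_⟩
  rw [← Real.exp_add, Real.log_exp]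
  linarith

/-- A limit of points of `D` at bounded Hilbert distance from a point of `D` lies in `D`. -/
lemma mem_of_tendsto (hDo : IsOpen D) (hDc : Convex ℝ D) (hd : IsHilbertMetric D d)
    {p y : V} (hp : p ∈ D) {v : ℕ → V} (hv : ∀ n, v n ∈ D) (hlim : Tendsto v atTop (𝓝 y))
    {C : ℝ} (hC : ∀ᶠ n in atTop, d p (v n) ≤ C) : y ∈ D := by
  have hβ : (0 : ℝ) < Real.exp C + 1 - 1 := by simpa using Real.exp_pos C
  refine mem_of_isFunkBound hDo hDc hp (β := Real.exp C + 1)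
    ⟨by linarith, (Real.exp C + 1 - 1)⁻¹ • ((Real.exp C + 1) • y - p), ?_,
      (smul_inv_smul₀ hβ.ne' _).symm⟩
  have hlim' : Tendsto (fun n => (Real.exp C + 1 - 1)⁻¹ • ((Real.exp C + 1) • v n - p)) atTop
      (𝓝 ((Real.exp C + 1 - 1)⁻¹ • ((Real.exp C + 1) • y - p))) :=
    ((hlim.const_smul _).sub_const _).const_smul _
  refine isClosed_closure.mem_of_tendsto hlim' ?_
  filter_upwards [hC] with n hn
  have h1 := one_le_expFunk hDo hDc hd hp (hv n)
  have h2 := one_le_expFunk hDo hDc hd (hv n) hp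
  rw [eq_log_expFunk hDo hDc hd hp (hv n), Real.log_le_iff_le_exp (by positivity)] at hn
  obtain ⟨-, c, hc, hce⟩ := (isLeast_expFunk hDo hDc hd hp (hv n)).1.mono hDc (hv n)
    (γ := Real.exp C + 1) (by nlinarith)
  rw [hce, inv_smul_smul₀ hβ.ne']
  exact hc

/-- Under the convexity condition on the Hilbert metric, resolvents of a nonexpansive map are
nonexpansive. -/
lemma resolvent_nonexpansive (hDo : IsOpen D) (hDc : Convex ℝ D) (hd : IsHilbertMetric D d)
    (hcondD : ∀ x ∈ D, ∀ y ∈ D, ∀ z ∈ D, ∀ w ∈ D, ∀ s ∈ Set.Icc (0 : ℝ) 1,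
      d (s • x + (1 - s) • y) (s • z + (1 - s) • w) ≤ max (d x z) (d y w))
    {F : V → V} (hFmaps : ∀ y ∈ D, F y ∈ D)
    (hFne : ∀ x ∈ D, ∀ y ∈ D, d (F x) (F y) ≤ d x y)
    {s : ℝ} (hs0 : 0 < s) (hs1 : s ≤ 1) {x u z z' : V} (hx : x ∈ D) (hu : u ∈ D)
    (hz : z ∈ D) (hz' : z' ∈ D) (hzx : z = s • x + (1 - s) • F z)
    (hzu : z' = s • u + (1 - s) • F z') : d z z' ≤ d x u := by
  by_contra! hlt
  have ha := hFmaps z hz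
  have hb := hFmaps z' hz'
  have hab := hFne z hz z' hz'
  set a := F z
  set b := F z'
  rcases eq_or_ne a b with h | hne
  · have h3 := hcondD x hx a ha u hu b hb s ⟨hs0.le, hs1⟩
    rw [← hzx, ← hzu, ← h, hd.1 a ha, max_eq_left (nonneg hDo hDc hd hx hu)] at h3
    linarith
  · have hlim : Tendsto (fun ε : ℝ => x - (ε * ((1 - s) / s)) • (b - a)) (𝓝[>] 0) (𝓝 x) := by
      have : ContinuousAt (fun ε : ℝ => x - (ε * ((1 - s) / s)) • (b - a)) 0 := by fun_prop
      have h2 : Tendsto (fun ε : ℝ => x - (ε * ((1 - s) / s)) • (b - a)) (𝓝 0) (𝓝 x) := by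
        simpa [ContinuousAt] using this
      exact h2.mono_left nhdsWithin_le_nhds
    have hev := hlim.eventually (eventually_lt hDo hDc hd hx (sub_pos.2 hlt))
    have hIoo : ∀ᶠ ε : ℝ in 𝓝[>] 0, ε ∈ Set.Ioo (0 : ℝ) 1 :=
      Ioo_mem_nhdsGT one_pos
    obtain ⟨ε, ⟨hx'D, hx'⟩, hε0, hε1⟩ := (hev.and hIoo).exists
    set x' := x - (ε * ((1 - s) / s)) • (b - a) with hx'def
    have ha'D : (1 - ε) • a + ε • b ∈ D := hDc ha hb (by linarith) hε0.le (by ring)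
    have hgeo := add_le_of_combo hDo hDc hd ha hb hε0.le hε1.le
    have hpos : 0 < d a ((1 - ε) • a + ε • b) := by
      refine pos hDo hDc hd ha ha'D fun h => hne ?_
      have : ε • (b - a) = 0 := by
        calc ε • (b - a) = ((1 - ε) • a + ε • b) - a := by module
          _ = 0 := by rw [← h, sub_self]
      rcases smul_eq_zero.1 this with h | h
      · exact absurd h hε0.ne'
      · exact (sub_eq_zero.1 h).symm
    have htri := triangle hDo hDc hd hx'D hx hu
    rw [symm hDo hDc hd hx'D hx] at htri
    have h3 := hcondD x' hx'D _ ha'D u hu b hb s ⟨hs0.le, hs1⟩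
    have e : s • x' + (1 - s) • ((1 - ε) • a + ε • b) = z := by
      rw [hzx, hx'def]
      match_scalars <;> field_simp <;> ring
    rw [e, ← hzu] at h3
    rcases le_max_iff.1 h3 with h | h <;> linarith

end IsHilbertMetric

theorem karlsson_nussbaum_for_resolvents
    {V : Type*} [NormedAddCommGroup V] [NormedSpace ℝ V] [FiniteDimensional ℝ V]
    (D : Set V) (hDo : IsOpen D) (hDc : Convex ℝ D) (hDb : Bornology.IsBounded D)
    (hDn : D.Nonempty)
    (dH : V → V → ℝ) (hdH : IsHilbertMetric D dH)
    (hcondD : ∀ x ∈ D, ∀ y ∈ D, ∀ z ∈ D, ∀ w ∈ D, ∀ s ∈ Set.Icc (0 : ℝ) 1,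
      dH (s • x + (1 - s) • y) (s • z + (1 - s) • w) ≤ max (dH x z) (dH y w))
    (F : V → V) (hFmaps : ∀ y ∈ D, F y ∈ D)
    (hFne : ∀ x ∈ D, ∀ y ∈ D, dH (F x) (F y) ≤ dH x y)
    (hFfix : ∀ x ∈ D, F x ≠ x)
    (R : ℝ → V → V)
    (hR : ∀ lam : ℝ, 0 < lam → ∀ x ∈ D, R lam x ∈ D ∧
      R lam x = (1 / (1 + lam)) • x + (lam / (1 + lam)) • F (R lam x)) :
    convexHull ℝ {y : V | ∃ x ∈ D, ∃ l : ℕ → ℝ, (∀ n, 0 < l n) ∧ StrictMono l ∧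
        Filter.Tendsto l Filter.atTop Filter.atTop ∧ y ∈ closure D ∧
        Filter.Tendsto (fun n => ‖R (l n) x - y‖) Filter.atTop (nhds 0)}
      ⊆ closure D \ D := by
  have hnonexp : ∀ x ∈ D, ∀ x' ∈ D, ∀ lam mu : ℝ, 0 < lam → lam ≤ mu →
      dH (R lam x) (R mu x') ≤ max (dH x x') (dH x (R mu x')) := by
    intro x hx x' hx' lam mu hlam hle
    have hmu : 0 < mu := hlam.trans_le hle
    obtain ⟨hz, hzx⟩ := hR lam hlam x hx
    obtain ⟨hz', hzx'⟩ := hR mu hmu x' hx'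
    have hratio : lam / mu ∈ Set.Icc (0 : ℝ) 1 :=
      ⟨by positivity, (div_le_one hmu).2 hle⟩
    have hu : (lam / mu) • x' + (1 - lam / mu) • R mu x' ∈ D :=
      hDc hx' hz' hratio.1 (by linarith [hratio.2]) (by ring)
    have hcoef : (1 : ℝ) - 1 / (1 + lam) = lam / (1 + lam) := by field_simp; ring
    have hsub : mu • (R mu x' - F (R mu x')) = x' - R mu x' := by
      have h : (1 + mu) • R mu x' = x' + mu • F (R mu x') := by
        conv_lhs => rw [hzx']
        match_scalars <;> field_simp
      rw [add_smul, one_smul] at h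
      rw [smul_sub, sub_eq_sub_iff_add_eq_add, add_comm, h]
    have hzu : R mu x' = (1 / (1 + lam)) • ((lam / mu) • x' + (1 - lam / mu) • R mu x') +
        (1 - 1 / (1 + lam)) • F (R mu x') := by
      have h : x' = R mu x' + mu • (R mu x' - F (R mu x')) := by rw [hsub]; abel
      generalize R mu x' = z at h
      rw [h]
      match_scalars <;> field_simp <;> ring
    rw [← hcoef] at hzx
    refine (hdH.resolvent_nonexpansive hDo hDc hcondD hFmaps hFne (s := 1 / (1 + lam))
      (by positivity) ((div_le_one (by positivity)).2 (by linarith)) hx hu hz hz' hzx hzu).trans ?_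
    have h := hcondD x hx x hx x' hx' (R mu x') hz' _ hratio
    rwa [← add_smul, add_sub_cancel, one_smul] at h
  set Ω : Set V := {y : V | ∃ x ∈ D, ∃ l : ℕ → ℝ, (∀ n, 0 < l n) ∧ StrictMono l ∧
        Filter.Tendsto l Filter.atTop Filter.atTop ∧ y ∈ closure D ∧
        Filter.Tendsto (fun n => ‖R (l n) x - y‖) Filter.atTop (nhds 0)} with hΩ
  have hΩnot : ∀ y ∈ Ω, y ∉ D := by
    rintro y ⟨x, hx, l, hl0, -, hl, -, hy⟩ hyD
    have hz : Tendsto (fun n => R (l n) x) atTop (𝓝 y) :=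
      tendsto_iff_norm_sub_tendsto_zero.2 hy
    have hFz : Tendsto (fun n => F (R (l n) x)) atTop (𝓝 y) := by
      have h : ∀ n, F (R (l n) x) = R (l n) x + (l n)⁻¹ • (R (l n) x - x) := by
        intro n
        have hn := hl0 n
        have h1 := (hR (l n) hn x hx).2
        generalize R (l n) x = z at h1 ⊢
        have h2 : (1 + l n) • z = x + l n • F z := by
          conv_lhs => rw [h1]
          match_scalars <;> field_simp
        have h3 : l n • F z = l n • z + (z - x) := by
          rw [add_smul, one_smul] at h2
          rw [← sub_eq_iff_eq_add'.2 h2]; abel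
        rw [← inv_smul_smul₀ hn.ne' (F z), h3, smul_add, inv_smul_smul₀ hn.ne']
      simp only [h]
      simpa using hz.add ((tendsto_inv_atTop_zero.comp hl).smul (hz.sub_const x))
    have hFyD := hFmaps y hyD
    have hpos := hdH.pos hDo hDc hyD hFyD (hFfix y hyD).symm
    have h1 := hz.eventually (hdH.eventually_lt hDo hDc hyD (half_pos hpos))
    have h2 := hFz.eventually (hdH.eventually_lt hDo hDc hyD (half_pos hpos))
    obtain ⟨n, ⟨hn1, hn2⟩, hn3, hn4⟩ := (h1.and h2).exists
    have h3 := hdH.triangle hDo hDc hyD hn3 hFyD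
    have h4 := hFne _ hn1 y hyD
    rw [hdH.symm hDo hDc hn1 hyD] at h4
    linarith
  obtain ⟨p, hp⟩ := hDn
  set Q : Set V := {y : V | ∃ v : ℕ → V, (∀ n, v n ∈ D) ∧ Tendsto v atTop (𝓝 y) ∧
    ∀ x ∈ D, ∃ C, ∀ n, ∀ᶠ mu in atTop, dH (v n) (R mu x) ≤ dH p (R mu x) + C} with hQ
  have hΩQ : Ω ⊆ Q := by
    rintro y ⟨x, hx, l, hl0, -, -, -, hy⟩
    refine ⟨fun n => R (l n) x, fun n => (hR _ (hl0 n) x hx).1,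
      tendsto_iff_norm_sub_tendsto_zero.2 hy, fun x' hx' => ⟨dH x x' + dH x p, fun n => ?_⟩⟩
    filter_upwards [eventually_ge_atTop (l n)] with mu hmu
    have hD := (hR mu ((hl0 n).trans_le hmu) x' hx').1
    have h1 := hdH.triangle hDo hDc hx hp hD
    have h2 := hdH.nonneg hDo hDc hx hp
    have h3 := hdH.nonneg hDo hDc hx hx'
    have h4 := hdH.nonneg hDo hDc hp hD
    exact (hnonexp x hx x' hx' (l n) mu (hl0 n) hmu).trans (max_le (by linarith) (by linarith))
  have hQc : Convex ℝ Q := by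
    rintro y ⟨v, hv, hvy, hvQ⟩ y' ⟨v', hv', hvy', hvQ'⟩ a b ha hb hab
    refine ⟨fun n => a • v n + b • v' n, fun n => hDc (hv n) (hv' n) ha hb hab,
      (hvy.const_smul a).add (hvy'.const_smul b), fun x hx => ?_⟩
    obtain ⟨C, hC⟩ := hvQ x hx
    obtain ⟨C', hC'⟩ := hvQ' x hx
    refine ⟨max C C', fun n => ?_⟩
    filter_upwards [hC n, hC' n, eventually_gt_atTop 0] with mu h1 h2 hmu
    have hD := (hR mu hmu x hx).1
    obtain rfl : b = 1 - a := by linarith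
    have h := hcondD (v n) (hv n) (v' n) (hv' n) _ hD _ hD a ⟨ha, by linarith⟩
    rw [← add_smul, add_sub_cancel, one_smul] at h
    refine h.trans (max_le ?_ ?_)
    · linarith [le_max_left C C']
    · linarith [le_max_right C C']
  have hstep : ∀ v ∈ Q, ∀ y ∈ Ω, ∀ a : ℝ, 0 ≤ a → a ≤ 1 → (1 - a) • v + a • y ∈ D → v ∈ D := by
    rintro w ⟨v, hv, hvw, hvQ⟩ y ⟨x, hx, l, hl0, -, hl, -, hy⟩ a ha0 ha1 hmem
    have hz : Tendsto (fun n => R (l n) x) atTop (𝓝 y) :=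
      tendsto_iff_norm_sub_tendsto_zero.2 hy
    obtain ⟨C, hC⟩ := hvQ x hx
    have hsel : ∀ n, ∃ k, n ≤ k ∧ dH (v n) (R (l k) x) ≤ dH p (R (l k) x) + C := fun n =>
      ((eventually_ge_atTop n).and (hl.eventually (hC n))).exists
    choose k hnk hk using hsel
    have hzk : Tendsto (fun n => R (l (k n)) x) atTop (𝓝 y) :=
      hz.comp (tendsto_atTop_mono hnk tendsto_id)
    have hcombo := (hvw.const_smul (1 - a)).add (hzk.const_smul a)
    refine hdH.mem_of_tendsto hDo hDc hp hv hvw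
      (C := 2 * (dH p ((1 - a) • w + a • y) + 1) + C) ?_
    filter_upwards [hcombo.eventually (hdH.eventually_lt hDo hDc hmem one_pos)] with n hn
    obtain ⟨hD, hlt⟩ := hn
    have hzD := (hR _ (hl0 (k n)) x hx).1
    have h1 := hdH.add_le_of_combo hDo hDc (hv n) hzD ha0 ha1
    have h2 := hdH.triangle hDo hDc hp hD hzD
    have h3 := hdH.triangle hDo hDc hp hD (hv n)
    have h4 := hdH.triangle hDo hDc hp hmem hD
    rw [hdH.symm hDo hDc hD (hv n)] at h3
    linarith [hk n]
  have hfin : ∀ t : Finset V, (t : Set V) ⊆ Ω → ∀ v ∈ convexHull ℝ (t : Set V), v ∉ D := by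
    classical
    intro t
    induction t using Finset.induction_on with
    | empty => simp
    | insert y t _ ih =>
      intro hsub v hv hvD
      rw [Finset.coe_insert, Set.insert_subset_iff] at hsub
      rw [Finset.coe_insert] at hv
      rcases t.eq_empty_or_nonempty with rfl | hne
      · simp only [Finset.coe_empty, insert_empty_eq, convexHull_singleton,
          Set.mem_singleton_iff] at hv
        exact hΩnot y hsub.1 (hv ▸ hvD)
      · rw [convexHull_insert (by simpa using hne), mem_convexJoin] at hv
        obtain ⟨y', rfl, u, hu, a, b, ha, hb, hab, rfl⟩ := hv
        obtain rfl : b = 1 - a := by linarith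
        rw [add_comm] at hvD
        exact ih hsub.2 u hu (hstep u
          (convexHull_min (hsub.2.trans hΩQ) hQc hu) _ hsub.1 a ha (by linarith) hvD)
  intro v hv
  refine ⟨convexHull_min (fun y hy => ?_) hDc.closure hv, ?_⟩
  · obtain ⟨x, -, l, -, -, -, hy, -⟩ := hy
    exact hy
  · rw [convexHull_eq_union_convexHull_finite_subsets] at hv
    simp only [Set.mem_iUnion] at hv
    obtain ⟨t, ht, hv⟩ := hv
    exact hfin t ht v hv
end
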